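/- (Theorem 1.1, first identity.) As formal power series in ℤ⟦q⟧: ψ(q)·(φ(q)² − φ(q⁷)²) = 4q·ψ(q²)·ψ(q⁷)·φ(q⁷) + 8q²·ψ(q¹⁴)·ψ(q³)·φ(q²¹) + 8q⁴·ψ(q¹⁴)·f(q,q²)·f(q⁷,q³⁵). -/

import Mathlib

open PowerSeries

/-- `phi k` is the theta series `φ(q^k)`, i.e. the formal power
series whose coefficient of `qⁿ` is `#{m ∈ ℤ : n = k·m²}`. -/
noncomputable def phi (k : ℕ) : PowerSeries ℤ :=
  PowerSeries.mk fun n => ({m : ℤ | (n : ℤ) = k * m ^ 2}.ncard : ℤ)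

/-- `psi k` is the theta series `ψ(q^k)`, i.e. the formal
power series whose coefficient of `qⁿ` is `#{m ∈ ℤ, m ≥ 0 : n = k·m(m+1)/2}`. -/
noncomputable def psi (k : ℕ) : PowerSeries ℤ :=
  PowerSeries.mk fun n => ({m : ℤ | 0 ≤ m ∧ (n : ℤ) = k * (m * (m + 1) / 2)}.ncard : ℤ)

/-- `fA k` is Ramanujan's `f(q,q²)` with `q` replaced by `q^k`,
i.e. the formal power series whose coefficient of `qⁿ` is `#{m ∈ ℤ : n = k·m(3m+1)/2}`. -/
noncomputable def fA (k : ℕ) : PowerSeries ℤ :=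
  PowerSeries.mk fun n => ({m : ℤ | (n : ℤ) = k * (m * (3 * m + 1) / 2)}.ncard : ℤ)

/-- `fB k` is Ramanujan's `f(q,q⁵)` with `q` replaced by `q^k`,
i.e. the formal power series whose coefficient of `qⁿ` is `#{m ∈ ℤ : n = k·m(3m+2)}`. -/
noncomputable def fB (k : ℕ) : PowerSeries ℤ :=
  PowerSeries.mk fun n => ({m : ℤ | (n : ℤ) = k * (m * (3 * m + 2))}.ncard : ℤ)


namespace Thm11
open Complex

/-- theta in q = exp(2 pi i z) -/
noncomputable def ph (z : ℂ) : ℂ := jacobiTheta (2 * z)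

lemma th_S (t : ℂ) (ht : 0 < t.im) : jacobiTheta (-1 / t) ^ 2 = (-I * t) * jacobiTheta t ^ 2 := by
  have h := jacobiTheta_S_smul ⟨t, ht⟩
  rw [UpperHalfPlane.modular_S_smul] at h
  have h2 : ((UpperHalfPlane.mk (-(⟨t, ht⟩ : UpperHalfPlane) : ℂ)⁻¹
      (UpperHalfPlane.im_inv_neg_coe_pos _) : UpperHalfPlane) : ℂ) = -1 / t := by
    show (-t)⁻¹ = -1 / t
    rw [inv_neg, neg_div, one_div]
  rw [h2] at h
  rw [h, mul_pow]
  congr 1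
  rw [← Complex.cpow_nat_mul]
  norm_num

lemma ph_add_one (z : ℂ) : ph (z + 1) = ph z := by
  unfold ph
  rw [show 2 * (z + 1) = 2 + 2 * z by ring, jacobiTheta_two_add]

lemma ph_sub_one (z : ℂ) : ph (z - 1) = ph z := by
  rw [← ph_add_one]; congr 1; ring

lemma ph_add_int (z : ℂ) (n : ℤ) : ph (z + n) = ph z := by
  induction n with
  | zero => simp
  | succ k ih => push_cast at *; rw [← add_assoc, ph_add_one, ih]
  | pred k ih => push_cast at *; rw [← add_sub_assoc, ph_sub_one, ih]

lemma neg_one_div_im (t : ℂ) (ht : 0 < t.im) : 0 < (-1 / t).im := by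
  have h := UpperHalfPlane.im_inv_neg_coe_pos ⟨t, ht⟩
  have : (-1 / t) = (-t)⁻¹ := by rw [inv_neg, neg_div, one_div]
  rw [this]; exact h

lemma ph_V (z : ℂ) (hz : 0 < z.im) : ph (z / (1 + 4 * z)) ^ 2 = (1 + 4 * z) * ph z ^ 2 := by
  unfold ph
  have hw : 0 < (2 * z).im := by simpa using hz
  set w := 2 * z with hwd
  have hw0 : w ≠ 0 := by rintro h; rw [h] at hw; simp at hw
  have hz' : 0 < (-1 / w - 2).im := by simpa using neg_one_div_im w hw
  have hz0 : (-1 / w - 2) ≠ 0 := by intro h; rw [h] at hz'; simp at hz'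
  have h1 := th_S _ hz'
  have h2 := th_S w hw
  have h3 : jacobiTheta (-1 / w - 2) = jacobiTheta (-1 / w) := by
    rw [← jacobiTheta_two_add]; congr 1; ring
  have hne : 1 + 2 * w ≠ 0 := by
    intro h
    apply hz0
    field_simp
    linear_combination -h
  have h4 : -1 / (-1 / w - 2) = 2 * (z / (1 + 4 * z)) := by
    have : 1 + 4 * z = 1 + 2 * w := by rw [hwd]; ring
    rw [this, ← mul_div_assoc, ← hwd]
    rw [div_eq_div_iff hz0 hne]
    field_simp
    ring
  rw [h4, h3, h2] at h1
  rw [h1]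
  have : (-1 / w - 2) * w = -(1 + 4 * z) := by field_simp; rw [hwd]; ring
  linear_combination (I ^ 2 * jacobiTheta w ^ 2) * this - (1 + 4 * z) * jacobiTheta w ^ 2 * I_sq

lemma den_ne (c D : ℤ) (h : c ≠ 0 ∨ D ≠ 0) (z : ℂ) (hz : 0 < z.im) : (c : ℂ) * z + D ≠ 0 := by
  intro h0
  have h1 := congrArg Complex.im h0
  simp at h1
  rcases h1 with h1 | h1
  · subst h1
    simp at h0
    simp [h0] at h
  · exact hz.ne' h1

lemma mob_im {a b c D : ℤ} (h : a * D - b * c = 1) (z : ℂ) (hz : 0 < z.im) :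
    0 < (((a : ℂ) * z + b) / (c * z + D)).im := by
  let g : Matrix.SpecialLinearGroup (Fin 2) ℤ := ⟨!![a, b; c, D], by rw [Matrix.det_fin_two_of]; exact h⟩
  have := (g • (⟨z, hz⟩ : UpperHalfPlane)).im_pos
  rw [← UpperHalfPlane.coe_im, UpperHalfPlane.specialLinearGroup_apply] at this
  simpa [g] using this

lemma V_im (z : ℂ) (hz : 0 < z.im) : 0 < (z / (1 + 4 * z)).im := by
  have := mob_im (a := 1) (b := 0) (c := 4) (D := 1) (by norm_num) z hz
  rw [add_comm 1]; simpa using this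

lemma V_im' (z : ℂ) (hz : 0 < z.im) : 0 < (z / (1 - 4 * z)).im := by
  have := mob_im (a := 1) (b := 0) (c := -4) (D := 1) (by norm_num) z hz
  rw [sub_eq_add_neg, add_comm 1]; simpa using this

lemma ph_V' (z : ℂ) (hz : 0 < z.im) : ph (z / (1 - 4 * z)) ^ 2 = (1 - 4 * z) * ph z ^ 2 := by
  have h := ph_V _ (V_im' z hz)
  have hne : 1 - 4 * z ≠ 0 := by
    have := den_ne (-4) 1 (by norm_num) z hz
    intro h; apply this; push_cast; linear_combination h
  have e1 : 1 + 4 * (z / (1 - 4 * z)) = 1 / (1 - 4 * z) := by field_simp; ring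
  have e2 : z / (1 - 4 * z) / (1 + 4 * (z / (1 - 4 * z))) = z := by
    rw [e1, div_div_eq_mul_div, div_one, div_mul_cancel₀ _ hne]
  rw [e2, e1] at h
  rw [h, ← mul_assoc, mul_one_div_cancel hne, one_mul]

/-- the sq law -/
lemma ph_sq : ∀ (N : ℕ) (a b c D : ℤ), c.natAbs + D.natAbs = N → a * D - b * c = 1 → 4 ∣ c → D % 4 = 1 →
    ∀ z : ℂ, 0 < z.im → ph ((a * z + b) / (c * z + D)) ^ 2 = (c * z + D) * ph z ^ 2 := by
  intro N
  induction N using Nat.strong_induction_on with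
  | _ N ih =>
  intro a b c D hN hdet hc hD z hz
  have hD0 : D ≠ 0 := by rintro rfl; simp at hD
  by_cases hc0 : c = 0
  · subst hc0
    have h1 : a * D = 1 := by linarith
    have h2 : D = 1 := by
      rcases Int.eq_one_or_neg_one_of_mul_eq_one (by rw [mul_comm]; exact h1 : D * a = 1) with h | h
      · exact h
      · subst h; norm_num at hD
    subst h2
    have h3 : a = 1 := by linarith
    subst h3
    simp [ph_add_int]
  have hden := den_ne c D (Or.inl hc0) z hz
  by_cases hcase : c.natAbs < 2 * D.natAbs
  · -- reduce D
    by_cases hs : (0 < c ∧ 0 < D) ∨ (c < 0 ∧ D < 0)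
    · -- D - c
      have := ih _ (by omega) a (b - a) c (D - c) rfl (by linarith) hc (by omega) (z + 1) (by simpa using hz)
      rw [ph_add_one] at this
      rw [show (a : ℂ) * (z + 1) + (b - a : ℤ) = a * z + b by push_cast; ring,
        show (c : ℂ) * (z + 1) + (D - c : ℤ) = c * z + D by push_cast; ring] at this
      exact this
    · have := ih _ (by omega) a (b + a) c (D + c) rfl (by linarith) hc (by omega) (z - 1) (by simpa using hz)
      rw [ph_sub_one] at this
      rw [show (a : ℂ) * (z - 1) + (b + a : ℤ) = a * z + b by push_cast; ring,
        show (c : ℂ) * (z - 1) + (D + c : ℤ) = c * z + D by push_cast; ring] at this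
      exact this
  · have hlt : 2 * D.natAbs < c.natAbs := by
      by_contra hcon
      omega
    by_cases hs : (0 < c ∧ 0 < D) ∨ (c < 0 ∧ D < 0)
    · have := ih _ (by omega) (a - 4 * b) b (c - 4 * D) D rfl (by linarith) (by omega) hD _ (V_im z hz)
      have hv := den_ne 4 1 (by norm_num) z hz
      have hv' : 1 + 4 * z ≠ 0 := by rw [add_comm]; simpa using hv
      rw [ph_V z hz] at this
      rw [show ((a - 4 * b : ℤ) : ℂ) * (z / (1 + 4 * z)) + b = (a * z + b) / (1 + 4 * z) by
            push_cast; field_simp; ring,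
          show ((c - 4 * D : ℤ) : ℂ) * (z / (1 + 4 * z)) + D = (c * z + D) / (1 + 4 * z) by
            push_cast; field_simp; ring, div_div_div_cancel_right₀ hv'] at this
      rw [this, ← mul_assoc, div_mul_cancel₀ _ hv']
    · have := ih _ (by omega) (a + 4 * b) b (c + 4 * D) D rfl (by linarith) (by omega) hD _ (V_im' z hz)
      have hv := den_ne (-4) 1 (by norm_num) z hz
      have hv' : 1 - 4 * z ≠ 0 := by
        intro h; apply hv; push_cast; linear_combination h
      rw [ph_V' z hz] at this
      rw [show ((a + 4 * b : ℤ) : ℂ) * (z / (1 - 4 * z)) + b = (a * z + b) / (1 - 4 * z) by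
            push_cast; field_simp; ring,
          show ((c + 4 * D : ℤ) : ℂ) * (z / (1 - 4 * z)) + D = (c * z + D) / (1 - 4 * z) by
            push_cast; field_simp; ring, div_div_div_cancel_right₀ hv'] at this
      rw [this, ← mul_assoc, div_mul_cancel₀ _ hv']

end Thm11

namespace Thm11
open Complex Filter Topology

/-- upper half plane as a set -/
def UU : Set ℂ := {z : ℂ | 0 < z.im}

lemma UU_open : IsOpen UU := isOpen_lt continuous_const continuous_im

lemma UU_dom {f g : ℂ → ℂ} (hf : DifferentiableOn ℂ f UU) (hg : DifferentiableOn ℂ g UU)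
    (h : ∀ z ∈ UU, f z * g z = 0) : (∀ z ∈ UU, f z = 0) ∨ (∀ z ∈ UU, g z = 0) := by
  have hc : IsPreconnected UU := (convex_halfSpace_im_gt 0).isPreconnected
  exact AnalyticOnNhd.eq_zero_or_eq_zero_of_mul_eq_zero (hf.analyticOnNhd UU_open)
    (hg.analyticOnNhd UU_open) h hc

lemma UU_cancel {f g k : ℂ → ℂ} (hf : DifferentiableOn ℂ f UU) (hg : DifferentiableOn ℂ g UU)
    (hk : DifferentiableOn ℂ k UU) (hk0 : ∃ z ∈ UU, k z ≠ 0)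
    (h : ∀ z ∈ UU, f z * k z = g z * k z) : ∀ z ∈ UU, f z = g z := by
  rcases UU_dom (hf.sub hg) hk (fun z hz => by
    simp only [Pi.sub_apply]; linear_combination h z hz) with h1 | h1
  · intro z hz; exact sub_eq_zero.mp (h1 z hz)
  · obtain ⟨z, hz, hz'⟩ := hk0
    exact absurd (h1 z hz) hz'

lemma UU_sign {f g : ℂ → ℂ} (hf : DifferentiableOn ℂ f UU) (hg : DifferentiableOn ℂ g UU)
    (h : ∀ z ∈ UU, f z ^ 2 = g z ^ 2) : ∃ χ : ℂ, (χ = 1 ∨ χ = -1) ∧ ∀ z ∈ UU, f z = χ * g z := by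
  rcases UU_dom (hf.sub hg) (hf.add hg) (fun z hz => by
    simp only [Pi.sub_apply, Pi.add_apply]; linear_combination h z hz) with h1 | h1
  · refine ⟨1, Or.inl rfl, fun z hz => ?_⟩
    have := h1 z hz
    simp only [Pi.sub_apply] at this
    linear_combination this
  · refine ⟨-1, Or.inr rfl, fun z hz => ?_⟩
    have := h1 z hz
    simp only [Pi.add_apply] at this
    linear_combination this

lemma ph_diff (z : ℂ) (hz : z ∈ UU) : DifferentiableAt ℂ ph z := by
  unfold ph
  have h : 0 < (2 * z).im := by simpa using (show 0 < z.im from hz)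
  exact (differentiableAt_jacobiTheta h).comp z (by fun_prop)

lemma ph_tendsto : Tendsto ph (comap im atTop) (𝓝 1) := by
  have h1 : Tendsto (fun τ : ℂ => jacobiTheta τ - 1) (comap im atTop) (𝓝 0) := by
    refine isBigO_at_im_infty_jacobiTheta_sub_one.trans_tendsto ?_
    have : Tendsto (fun y : ℝ => Real.exp (-Real.pi * y)) atTop (𝓝 0) := by
      apply Real.tendsto_exp_atBot.comp
      exact tendsto_id.const_mul_atTop_of_neg (by linarith [Real.pi_pos])
    exact this.comp tendsto_comap
  have h2 : Tendsto (fun z : ℂ => 2 * z) (comap im atTop) (comap im atTop) := by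
    rw [tendsto_comap_iff]
    have : (im ∘ fun z : ℂ => 2 * z) = (fun y : ℝ => 2 * y) ∘ im := by ext z; simp
    rw [this]
    exact (tendsto_id.const_mul_atTop (by norm_num)).comp tendsto_comap
  have h3 := (h1.comp h2).add_const 1
  have h4 : (ph : ℂ → ℂ) = fun x => jacobiTheta (2 * x) := rfl
  rw [h4]
  simpa [Function.comp_def] using h3

/-- path to infinity -/
lemma path_tendsto (d : ℝ) (hd : 0 < d) (x : ℂ) :
    Tendsto (fun y : ℝ => (d : ℂ) * (y * I) + x) atTop (comap im atTop) := by
  rw [tendsto_comap_iff]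
  have : (im ∘ fun y : ℝ => (d : ℂ) * (y * I) + x) = fun y : ℝ => d * y + x.im := by ext z; simp
  rw [this]
  exact tendsto_atTop_add_const_right _ _ (tendsto_id.const_mul_atTop hd)

lemma ph_ne : ∃ z ∈ UU, ph z ≠ 0 := by
  have h := (ph_tendsto.comp (path_tendsto 1 one_pos 0)).eventually_ne one_ne_zero
  obtain ⟨y, hy, hy0⟩ := (h.and (eventually_gt_atTop 0)).exists
  refine ⟨_, ?_, hy⟩
  simp [UU, hy0]

/-- hasSum -/
lemma ph_hasSum (z : ℂ) (hz : z ∈ UU) : HasSum (fun n : ℤ => cexp (2 * Real.pi * I * n ^ 2 * z)) (ph z) := by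
  have h : 0 < (2 * z).im := by simpa using (show 0 < z.im from hz)
  have := hasSum_jacobiTheta₂_term (0 : ℂ) h
  unfold ph
  rw [jacobiTheta_eq_jacobiTheta₂]
  convert this using 2 with n
  unfold jacobiTheta₂_term
  congr 1
  ring

lemma HasSum_congr' {f g : ℤ → ℂ} {a : ℂ} (h : HasSum f a) (hfg : ∀ n, f n = g n) : HasSum g a := by
  have : f = g := funext hfg
  rw [← this]; exact h

lemma ph_sq_split (k : ℕ) (hk : k = 2 ∨ k = 3) (z : ℂ) (hz : z ∈ UU) :
    k * ph (k ^ 2 * z) = ∑ j ∈ Finset.range k, ph (z + j / k) := by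
  have hk0 : (k : ℂ) ≠ 0 := by rcases hk with rfl | rfl <;> norm_num
  have hk1 : 1 < k := by omega
  have hS : HasSum (fun n : ℤ => ∑ j ∈ Finset.range k, cexp (2 * Real.pi * I * n ^ 2 * (z + j / k)))
      (∑ j ∈ Finset.range k, ph (z + j / k)) := by
    refine hasSum_sum fun j _ => ph_hasSum _ ?_
    have : ((j : ℂ) / k).im = 0 := by
      rw [show ((j : ℂ) / k) = ((j / k : ℝ) : ℂ) by push_cast; rfl, ofReal_im]
    simpa [UU, this] using hz
  have hinj : Function.Injective (fun n : ℤ => (k : ℤ) * n) := by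
    intro a b h
    have : (k : ℤ) ≠ 0 := by omega
    exact mul_left_cancel₀ this h
  have hz2 : ((k : ℂ) ^ 2 * z) ∈ UU := by
    have : (k : ℂ) ^ 2 * z = ((k ^ 2 : ℝ) : ℂ) * z := by push_cast; rfl
    show 0 < ((k : ℂ) ^ 2 * z).im
    rw [this, im_ofReal_mul]
    have : 0 < k := by omega
    have hz' : 0 < z.im := hz
    positivity
  have hT := (ph_hasSum _ hz2).mul_left (k : ℂ)
  refine HasSum.unique hT ?_
  rw [← hinj.hasSum_iff] at hS
  · refine HasSum_congr' hS ?_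
    intro n
    have : ∀ j ∈ Finset.range k, cexp (2 * Real.pi * I * ((k * n : ℤ) : ℂ) ^ 2 * (z + j / k)) =
        cexp (2 * Real.pi * I * n ^ 2 * (k ^ 2 * z)) := by
      intro j _
      have : (2 * Real.pi * I * ((k * n : ℤ) : ℂ) ^ 2 * (z + j / k)) =
        (2 * Real.pi * I * n ^ 2 * (k ^ 2 * z)) + ((k * n ^ 2 * j : ℤ) : ℂ) * (2 * Real.pi * I) := by
        push_cast; field_simp
      rw [this, Complex.exp_add, Complex.exp_int_mul_two_pi_mul_I, mul_one]
    simp only [Function.comp]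
    rw [Finset.sum_congr rfl this]
    simp
  · intro n hn
    have hnk : ¬ (k : ℤ) ∣ n := by
      rintro ⟨m, rfl⟩; exact hn ⟨m, rfl⟩
    obtain ⟨r, hr⟩ : ∃ r : ℤ, n ^ 2 = k * r + 1 := by
      rcases hk with rfl | rfl
      · have : n % 2 = 1 := by omega
        obtain ⟨m, hm⟩ : ∃ m, n = 2 * m + 1 := ⟨n / 2, by omega⟩
        exact ⟨2 * m ^ 2 + 2 * m, by rw [hm]; push_cast; ring⟩
      · have : n % 3 = 1 ∨ n % 3 = 2 := by omega
        rcases this with h | h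
        · obtain ⟨m, hm⟩ : ∃ m, n = 3 * m + 1 := ⟨n / 3, by omega⟩
          exact ⟨3 * m ^ 2 + 2 * m, by rw [hm]; push_cast; ring⟩
        · obtain ⟨m, hm⟩ : ∃ m, n = 3 * m + 2 := ⟨n / 3, by omega⟩
          exact ⟨3 * m ^ 2 + 4 * m + 1, by rw [hm]; push_cast; ring⟩
    have hgs := (Complex.isPrimitiveRoot_exp k (by omega)).geom_sum_eq_zero hk1
    have hr' : (n : ℂ) ^ 2 = k * r + 1 := by exact_mod_cast hr
    have : ∀ j ∈ Finset.range k, cexp (2 * Real.pi * I * (n : ℂ) ^ 2 * (z + j / k)) =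
        cexp (2 * Real.pi * I * n ^ 2 * z) * cexp (2 * Real.pi * I / k) ^ j := by
      intro j _
      have : (2 * Real.pi * I * (n : ℂ) ^ 2 * (z + j / k)) =
        (2 * Real.pi * I * n ^ 2 * z) + (j * (2 * Real.pi * I / k)) + ((r * j : ℤ) : ℂ) * (2 * Real.pi * I) := by
        rw [hr']; push_cast; field_simp; ring
      rw [this, Complex.exp_add, Complex.exp_int_mul_two_pi_mul_I, mul_one, Complex.exp_add,
        Complex.exp_nat_mul]
    rw [Finset.sum_congr rfl this, ← Finset.mul_sum, hgs, mul_zero]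

end Thm11

namespace Thm11
open Complex Filter Topology

/-- Moebius map -/
noncomputable def mob (a b c D : ℤ) (z : ℂ) : ℂ := (a * z + b) / (c * z + D)

lemma det_nz {a b c D : ℤ} (h : a * D - b * c = 1) : c ≠ 0 ∨ D ≠ 0 := by
  by_contra! hh
  rw [hh.1, hh.2] at h; simp at h

lemma mob_mem {a b c D : ℤ} (h : a * D - b * c = 1) {z : ℂ} (hz : z ∈ UU) : mob a b c D z ∈ UU :=
  mob_im h z hz

lemma mob_diff {a b c D : ℤ} (h : a * D - b * c = 1) : DifferentiableOn ℂ (mob a b c D) UU := by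
  unfold mob
  refine DifferentiableOn.div (by fun_prop) (by fun_prop) ?_
  intro z hz
  exact den_ne c D (det_nz h) z hz

/-- scaled theta -/
noncomputable def TH (d : ℕ) (z : ℂ) : ℂ := ph (d * z)

lemma smul_mem {d : ℕ} (hd : 0 < d) {z : ℂ} (hz : z ∈ UU) : (d : ℂ) * z ∈ UU := by
  have : (d : ℂ) = ((d : ℝ) : ℂ) := by push_cast; rfl
  show 0 < ((d : ℂ) * z).im
  rw [this, im_ofReal_mul]
  have hz' : 0 < z.im := hz
  positivity

lemma TH_diff {d : ℕ} (hd : 0 < d) : DifferentiableOn ℂ (TH d) UU := by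
  intro z hz
  apply DifferentiableAt.differentiableWithinAt
  exact (ph_diff _ (smul_mem hd hz)).comp z (by fun_prop)

lemma ph_diffOn : DifferentiableOn ℂ ph UU := fun z hz => (ph_diff z hz).differentiableWithinAt

lemma TH_tendsto {d : ℕ} (hd : 0 < d) : Tendsto (fun y : ℝ => TH d (y * I)) atTop (𝓝 1) := by
  have := ph_tendsto.comp (path_tendsto d (by exact_mod_cast hd) 0)
  simpa [Function.comp_def, TH] using this

lemma TH_ne {d : ℕ} (hd : 0 < d) : ∃ z ∈ UU, TH d z ≠ 0 := by
  have h := (TH_tendsto hd).eventually_ne one_ne_zero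
  obtain ⟨y, hy, hy0⟩ := (h.and (eventually_gt_atTop 0)).exists
  refine ⟨_, ?_, hy⟩
  simp [UU, hy0]

lemma add_real_mem {z : ℂ} (hz : z ∈ UU) (j k : ℕ) : z + (j / k : ℂ) ∈ UU := by
  have : ((j : ℂ) / k).im = 0 := by
    rw [show ((j : ℂ) / k) = ((j / k : ℝ) : ℂ) by push_cast; rfl, ofReal_im]
  show 0 < (z + (j / k : ℂ)).im
  rw [add_im, this, add_zero]; exact hz

lemma mob_comp_diff {a b c D : ℤ} (h : a * D - b * c = 1) {f : ℂ → ℂ} (hf : DifferentiableOn ℂ f UU) :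
    DifferentiableOn ℂ (fun z => f (mob a b c D z)) UU :=
  hf.comp (mob_diff h) (fun _ hz => mob_mem h hz)

/-- square law, scaled -/
lemma TH_sq {d : ℕ} (hd : 0 < d) {a b c D : ℤ} (h : a * D - b * c = 1) (hc : (4 * d : ℤ) ∣ c) (hD : D % 4 = 1)
    {z : ℂ} (hz : z ∈ UU) : TH d (mob a b c D z) ^ 2 = (c * z + D) * TH d z ^ 2 := by
  obtain ⟨c', rfl⟩ := hc
  have := ph_sq _ a (b * d) (4 * c') D rfl (by linarith) ⟨c', rfl⟩ hD _ (smul_mem hd hz)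
  unfold TH mob
  rw [show ((4 * c' : ℤ) : ℂ) * (d * z) + D = (4 * d * c' : ℤ) * z + D by push_cast; ring] at this
  rw [← this]
  congr 2
  rw [← mul_div_assoc]
  congr 1
  push_cast
  ring

lemma lemA_base (k : ℕ) (hk : k = 2 ∨ k = 3) {a b c D : ℤ} (h : a * D - b * c = 1)
    (hc : (4 * k ^ 2 : ℤ) ∣ c) (hD : D % 4 = 1) :
    ∀ z ∈ UU, ph (k ^ 2 * mob a b c D z) * ph z = ph (k ^ 2 * z) * ph (mob a b c D z) := by
  have hkpos : 0 < k := by omega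
  have hk0 : (k : ℂ) ≠ 0 := by exact_mod_cast hkpos.ne'
  obtain ⟨c', hc'⟩ := hc
  obtain ⟨m, hm⟩ : (k : ℤ) ∣ D - a := by
    rcases hk with rfl | rfl
    · have h2 : a * D % 2 = 1 := by
        have : a * D = 2 * (8 * (b * c')) + 1 := by rw [hc'] at h; push_cast at h; linarith
        omega
      have : a % 2 = 1 := by
        rcases Int.emod_two_eq_zero_or_one a with h | h
        · rw [Int.mul_emod, h] at h2; simp at h2
        · exact h
      push_cast
      omega
    · have h2 : a * D % 3 = 1 := by
        have : a * D = 3 * (12 * (b * c')) + 1 := by rw [hc'] at h; push_cast at h; linarith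
        omega
      have h3 : a % 3 = 0 ∨ a % 3 = 1 ∨ a % 3 = 2 := by omega
      have h4 : D % 3 = 0 ∨ D % 3 = 1 ∨ D % 3 = 2 := by omega
      push_cast
      rcases h3 with h3 | h3 | h3 <;> rcases h4 with h4 | h4 | h4 <;>
        rw [Int.mul_emod, h3, h4] at h2 <;> norm_num at h2 <;> omega
  have hDm : D = a + k * m := by linarith
  -- signs of translates
  have key : ∀ j : ℕ, ∃ χ : ℂ, (χ = 1 ∨ χ = -1) ∧ ∀ z ∈ UU,
      ph (mob a b c D z + j / k) * ph z = χ * (ph (z + j / k) * ph (mob a b c D z)) := by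
    intro j
    have dshift : DifferentiableOn ℂ (fun z : ℂ => ph (z + j / k)) UU :=
      ph_diffOn.comp (by fun_prop) (fun z hz => add_real_mem hz j k)
    refine UU_sign (((mob_comp_diff h dshift)).mul ph_diffOn) (dshift.mul (mob_comp_diff h ph_diffOn)) ?_
    intro z hz
    have e1 := ph_sq _ (a + 4 * k * j * c') (b + j * m - 4 * j ^ 2 * c') c (D - 4 * k * j * c') rfl
      (by rw [← h, hc', hDm]; ring) (by rw [hc']; exact ⟨k ^ 2 * c', by ring⟩) (by
        have : D - 4 * k * j * c' = D - 4 * (k * j * c') := by ring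
        rw [this]; omega) _ (add_real_mem hz j k)
    have hden := den_ne c D (det_nz h) z hz
    have e2 : (c : ℂ) * (z + j / k) + (D - 4 * k * j * c' : ℤ) = c * z + D := by
      rw [hc']; push_cast; field_simp; ring
    have e3 : ((a + 4 * k * j * c' : ℤ) : ℂ) * (z + j / k) + (b + j * m - 4 * j ^ 2 * c' : ℤ) =
        (a * z + b) + (j / k) * (c * z + D) := by
      rw [hc', hDm]; push_cast; field_simp; ring
    rw [e2, e3, add_div, mul_div_cancel_right₀ _ hden] at e1
    have e4 := ph_sq _ a b c D rfl h (by rw [hc']; exact ⟨k ^ 2 * c', by ring⟩) hD z hz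
    simp only [mob]
    rw [mul_pow, mul_pow, e1, e4]; ring
  have hsqd : DifferentiableOn ℂ (fun z : ℂ => ph (k ^ 2 * z)) UU := by
    have := TH_diff (d := k ^ 2) (by positivity)
    unfold TH at this
    push_cast at this
    exact this
  obtain ⟨χ, hχ, hχe⟩ : ∃ χ : ℂ, (χ = 1 ∨ χ = -1) ∧ ∀ z ∈ UU,
      ph (k ^ 2 * mob a b c D z) * ph z = χ * (ph (k ^ 2 * z) * ph (mob a b c D z)) := by
    refine UU_sign ((mob_comp_diff h hsqd).mul ph_diffOn) (hsqd.mul (mob_comp_diff h ph_diffOn)) ?_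
    intro z hz
    have e1 := TH_sq (d := k ^ 2) (by positivity) h (by rw [hc']; push_cast; exact ⟨c', by ring⟩) hD hz
    have e4 := ph_sq _ a b c D rfl h (by rw [hc']; exact ⟨k ^ 2 * c', by ring⟩) hD z hz
    unfold TH at e1
    push_cast at e1
    show (ph (k ^ 2 * mob a b c D z) * ph z) ^ 2 = (ph (k ^ 2 * z) * ph (mob a b c D z)) ^ 2
    rw [mul_pow, mul_pow, e1, mob, e4]; ring
  suffices hχ1 : χ = 1 by
    intro z hz; rw [hχe z hz, hχ1, one_mul]
  choose X hX1 hX2 using key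
  have hX0 : X 0 = 1 := by
    obtain ⟨z, hz, hne⟩ : ∃ z ∈ UU, ph z * ph (mob a b c D z) ≠ 0 := by
      by_contra! hcon
      rcases UU_dom ph_diffOn (mob_comp_diff h ph_diffOn) hcon with h1 | h1
      · obtain ⟨z, hz, hne⟩ := ph_ne
        exact hne (h1 z hz)
      · obtain ⟨z, hz, hne⟩ := ph_ne
        have e4 := ph_sq _ a b c D rfl h (by rw [hc']; exact ⟨k ^ 2 * c', by ring⟩) hD z hz
        have := h1 z hz
        simp only [mob] at this
        rw [this] at e4
        have hden := den_ne c D (det_nz h) z hz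
        simp [hden, hne] at e4
    have := hX2 0 z hz
    simp only [Nat.cast_zero, zero_div, add_zero] at this
    rw [mul_comm (ph (mob a b c D z))] at this
    have h3 : (X 0 - 1) * (ph z * ph (mob a b c D z)) = 0 := by linear_combination -this
    rcases mul_eq_zero.mp h3 with h4 | h4
    · linear_combination h4
    · exact absurd h4 hne
  -- cancel ph (mob z)
  have hcomb : ∀ z ∈ UU, (k * χ * ph (k ^ 2 * z)) * ph (mob a b c D z) =
      (∑ j ∈ Finset.range k, X j * ph (z + j / k)) * ph (mob a b c D z) := by
    intro z hz
    have e1 := hχe z hz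
    have e2 := ph_sq_split k hk _ (mob_mem h hz)
    rw [Finset.sum_mul]
    have e3 : ∀ j ∈ Finset.range k, X j * ph (z + j / k) * ph (mob a b c D z) =
        ph (mob a b c D z + j / k) * ph z := by
      intro j _; rw [hX2 j z hz]; ring
    rw [Finset.sum_congr rfl e3, ← Finset.sum_mul, ← e2]
    linear_combination (-k : ℂ) * e1
  have hsumd : DifferentiableOn ℂ (fun z => ∑ j ∈ Finset.range k, X j * ph (z + j / k)) UU := by
    refine DifferentiableOn.fun_sum fun j _ => ?_
    refine DifferentiableOn.const_mul ?_ _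
    exact ph_diffOn.comp (by fun_prop) (fun z hz => add_real_mem hz j k)
  have hne : ∃ z ∈ UU, ph (mob a b c D z) ≠ 0 := by
    obtain ⟨z, hz, hne⟩ := ph_ne
    refine ⟨z, hz, fun h0 => ?_⟩
    have e4 := ph_sq _ a b c D rfl h (by rw [hc']; exact ⟨k ^ 2 * c', by ring⟩) hD z hz
    simp only [mob] at h0
    rw [h0] at e4
    have hden := den_ne c D (det_nz h) z hz
    simp [hden, hne] at e4
  have hfin := UU_cancel (hsqd.const_mul (k * χ)) hsumd (mob_comp_diff h ph_diffOn) hne hcomb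
  have lim1 : Tendsto (fun y : ℝ => (k * χ) * ph (k ^ 2 * (y * I))) atTop (𝓝 (k * χ * 1)) := by
    have := (TH_tendsto (d := k ^ 2) (by positivity)).const_mul (k * χ)
    unfold TH at this
    push_cast at this
    exact this
  have lim2 : Tendsto (fun y : ℝ => ∑ j ∈ Finset.range k, X j * ph (y * I + j / k)) atTop
      (𝓝 (∑ j ∈ Finset.range k, X j * 1)) := by
    refine tendsto_finsetSum _ fun j _ => Tendsto.const_mul _ ?_
    have := ph_tendsto.comp (path_tendsto 1 one_pos (j / k))
    simpa [Function.comp_def] using this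
  have heq : k * χ * 1 = ∑ j ∈ Finset.range k, X j * 1 := by
    refine tendsto_nhds_unique (lim1.congr' ?_) lim2
    filter_upwards [eventually_gt_atTop 0] with y hy
    exact hfin (y * I) (by simp [UU, hy])
  rcases hχ with hχ | hχ
  · exact hχ
  exfalso
  rw [hχ] at heq
  rcases hk with rfl | rfl
  · rw [Finset.sum_range_succ, Finset.sum_range_one, hX0] at heq
    rcases hX1 1 with h1 | h1 <;> rw [h1] at heq <;> norm_num at heq
  · rw [Finset.sum_range_succ, Finset.sum_range_succ, Finset.sum_range_one, hX0] at heq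
    rcases hX1 1 with h1 | h1 <;> rcases hX1 2 with h2 | h2 <;> rw [h1, h2] at heq <;> norm_num at heq

end Thm11

namespace Thm11
open Complex Filter Topology

lemma lemA (k : ℕ) (hk : k = 2 ∨ k = 3) {d : ℕ} (hd : 0 < d) {a b c D : ℤ} (h : a * D - b * c = 1)
    (hc : (4 * k ^ 2 * d : ℤ) ∣ c) (hD : D % 4 = 1) :
    ∀ z ∈ UU, TH (k ^ 2 * d) (mob a b c D z) * TH d z = TH (k ^ 2 * d) z * TH d (mob a b c D z) := by
  intro z hz
  obtain ⟨c', rfl⟩ := hc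
  have := lemA_base k hk (a := a) (b := b * d) (c := 4 * k ^ 2 * c') (D := D)
    (by rw [← h]; ring) ⟨c', rfl⟩ hD _ (smul_mem hd hz)
  have e : mob a (b * d) (4 * k ^ 2 * c') D (d * z) = d * mob a b (4 * k ^ 2 * d * c') D z := by
    unfold mob
    rw [← mul_div_assoc]; push_cast; congr 1 <;> ring
  rw [e] at this
  unfold TH
  push_cast
  rw [mul_assoc ((k : ℂ) ^ 2) d, mul_assoc ((k : ℂ) ^ 2) d]
  exact this

/-- same multiplier -/
def Rel (a b c D : ℤ) (f g : ℂ → ℂ) : Prop :=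
  ∀ z ∈ UU, f (mob a b c D z) * g z = f z * g (mob a b c D z)

variable {a b c D : ℤ}

lemma Rel.refl (f : ℂ → ℂ) : Rel a b c D f f := fun _ _ => mul_comm _ _

lemma Rel.symm {f g : ℂ → ℂ} (h : Rel a b c D f g) : Rel a b c D g f :=
  fun z hz => by linear_combination -h z hz

lemma Rel.add {f f' g : ℂ → ℂ} (h : Rel a b c D f g) (h' : Rel a b c D f' g) : Rel a b c D (f + f') g :=
  fun z hz => by simp only [Pi.add_apply]; linear_combination h z hz + h' z hz

lemma Rel.sub {f f' g : ℂ → ℂ} (h : Rel a b c D f g) (h' : Rel a b c D f' g) : Rel a b c D (f - f') g :=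
  fun z hz => by simp only [Pi.sub_apply]; linear_combination h z hz - h' z hz

lemma Rel.smul {f g : ℂ → ℂ} (r : ℂ) (h : Rel a b c D f g) : Rel a b c D (r • f) g :=
  fun z hz => by simp only [Pi.smul_apply, smul_eq_mul]; linear_combination r * h z hz

lemma Rel.mul {f f' g g' : ℂ → ℂ} (h : Rel a b c D f g) (h' : Rel a b c D f' g') :
    Rel a b c D (f * f') (g * g') :=
  fun z hz => by
    simp only [Pi.mul_apply]
    linear_combination f' (mob a b c D z) * g' z * h z hz + f z * g (mob a b c D z) * h' z hz

lemma Rel.trans (hdet : a * D - b * c = 1) {f g k : ℂ → ℂ} (hf : DifferentiableOn ℂ f UU)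
    (hg : DifferentiableOn ℂ g UU) (hk : DifferentiableOn ℂ k UU) (hg0 : ∃ z ∈ UU, g z ≠ 0)
    (h : Rel a b c D f g) (h' : Rel a b c D g k) : Rel a b c D f k := by
  refine UU_cancel (k := g) ((mob_comp_diff hdet hf).mul hk) (hf.mul (mob_comp_diff hdet hk)) hg hg0 ?_
  intro z hz
  have h1 := h z hz
  have h2 := h' z hz
  linear_combination k z * h1 + f z * h2

/-- odd part -/
noncomputable def P1 (d : ℕ) : ℂ → ℂ := TH d - TH (4 * d)
/-- prime to three part -/
noncomputable def P2 (d : ℕ) : ℂ → ℂ := TH d - TH (9 * d)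
/-- prime to six part -/
noncomputable def P3 (d : ℕ) : ℂ → ℂ := TH d - TH (4 * d) - TH (9 * d) + TH (36 * d)

/-- first -/
noncomputable def u0 : ℂ → ℂ := (1 / 2 : ℂ) • (P1 3 * (TH 24 * TH 24 - TH 168 * TH 168))
/-- second -/
noncomputable def u1 : ℂ → ℂ := P1 6 * P1 21 * TH 168
/-- third -/
noncomputable def u2 : ℂ → ℂ := P1 42 * ((2 : ℂ) • (P1 9 * TH 504) + P3 1 * P2 56)

lemma P1_diff {d : ℕ} (hd : 0 < d) : DifferentiableOn ℂ (P1 d) UU :=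
  (TH_diff hd).sub (TH_diff (by omega))
lemma P2_diff {d : ℕ} (hd : 0 < d) : DifferentiableOn ℂ (P2 d) UU :=
  (TH_diff hd).sub (TH_diff (by omega))
lemma P3_diff {d : ℕ} (hd : 0 < d) : DifferentiableOn ℂ (P3 d) UU :=
  (((TH_diff hd).sub (TH_diff (by omega))).sub (TH_diff (by omega))).add (TH_diff (by omega))

lemma u0_diff : DifferentiableOn ℂ u0 UU :=
  ((P1_diff (by norm_num)).mul (((TH_diff (by norm_num)).mul (TH_diff (by norm_num))).sub
    ((TH_diff (by norm_num)).mul (TH_diff (by norm_num))))).const_smul (1 / 2 : ℂ)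
lemma u1_diff : DifferentiableOn ℂ u1 UU :=
  ((P1_diff (by norm_num)).mul (P1_diff (by norm_num))).mul (TH_diff (by norm_num))
lemma u2_diff : DifferentiableOn ℂ u2 UU :=
  (P1_diff (by norm_num)).mul ((((P1_diff (by norm_num)).mul (TH_diff (by norm_num))).const_smul (2 : ℂ)).add
    ((P3_diff (by norm_num)).mul (P2_diff (by norm_num))))

lemma rel4 (h : a * D - b * c = 1) (hD : D % 4 = 1) {d : ℕ} (hd : 0 < d) (hc : (16 * d : ℤ) ∣ c) :
    Rel a b c D (TH (4 * d)) (TH d) :=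
  lemA 2 (Or.inl rfl) hd h (by norm_num; exact hc) hD
lemma rel9 (h : a * D - b * c = 1) (hD : D % 4 = 1) {d : ℕ} (hd : 0 < d) (hc : (36 * d : ℤ) ∣ c) :
    Rel a b c D (TH (9 * d)) (TH d) :=
  lemA 3 (Or.inr rfl) hd h (by norm_num; exact hc) hD
lemma rel36 (h : a * D - b * c = 1) (hD : D % 4 = 1) {d : ℕ} (hd : 0 < d) (hc : (144 * d : ℤ) ∣ c) :
    Rel a b c D (TH (36 * d)) (TH d) := by
  have h1 := rel9 h hD (d := 4 * d) (by omega) (by push_cast; exact dvd_trans ⟨1, by ring⟩ hc)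
  have h2 := rel4 h hD (d := d) (by omega) (dvd_trans ⟨9, by ring⟩ hc)
  rw [← mul_assoc] at h1
  exact Rel.trans h (TH_diff (by omega)) (TH_diff (by omega)) (TH_diff (by omega)) (TH_ne (by omega)) h1 h2

lemma relP1 (h : a * D - b * c = 1) (hD : D % 4 = 1) {d : ℕ} (hd : 0 < d) (hc : (16 * d : ℤ) ∣ c) :
    Rel a b c D (P1 d) (TH d) := (Rel.refl _).sub (rel4 h hD hd hc)
lemma relP3 (h : a * D - b * c = 1) (hD : D % 4 = 1) {d : ℕ} (hd : 0 < d) (hc : (144 * d : ℤ) ∣ c) :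
    Rel a b c D (P3 d) (TH d) :=
  (((Rel.refl _).sub (rel4 h hD hd (dvd_trans ⟨9, by ring⟩ hc))).sub
    (rel9 h hD hd (dvd_trans ⟨4, by ring⟩ hc))).add (rel36 h hD hd hc)

lemma rel24 (h : a * D - b * c = 1) (hD : D % 4 = 1) {e d : ℕ} (hd : 0 < d) (he : 0 < e)
    (hc : (4 * d : ℤ) ∣ c) (hc' : (4 * e : ℤ) ∣ c) :
    Rel a b c D (TH d * TH d) (TH e * TH e) := by
  intro z hz
  have h1 := TH_sq hd h hc hD hz
  have h2 := TH_sq he h hc' hD hz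
  simp only [Pi.mul_apply]
  rw [← sq, ← sq, ← sq, ← sq, h1, h2]; ring

lemma sq_of_rel (h : a * D - b * c = 1) (hD : D % 4 = 1) {u : ℂ → ℂ} (hu : DifferentiableOn ℂ u UU)
    {d e f : ℕ} (hd : 0 < d) (he : 0 < e) (hf : 0 < f)
    (hdc : (4 * d : ℤ) ∣ c) (hec : (4 * e : ℤ) ∣ c) (hfc : (4 * f : ℤ) ∣ c)
    (hr : Rel a b c D u (TH d * TH e * TH f)) :
    ∀ z ∈ UU, u (mob a b c D z) ^ 2 = (c * z + D) ^ 3 * u z ^ 2 := by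
  have hm : DifferentiableOn ℂ (TH d * TH e * TH f) UU :=
    ((TH_diff hd).mul (TH_diff he)).mul (TH_diff hf)
  have hne : ∃ z ∈ UU, ((TH d * TH e * TH f) ^ 2) z ≠ 0 := by
    have h := ((((TH_tendsto hd).mul (TH_tendsto he)).mul (TH_tendsto hf)).eventually_ne
      (b₂ := 0) (by norm_num))
    obtain ⟨y, hy, hy0⟩ := (h.and (eventually_gt_atTop 0)).exists
    refine ⟨y * I, ?_, ?_⟩
    · simp [UU, hy0]
    · simp only [Pi.pow_apply, Pi.mul_apply]; exact pow_ne_zero _ hy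
  refine UU_cancel (k := (TH d * TH e * TH f) ^ 2) ((mob_comp_diff h hu).pow 2) ?_ (hm.pow 2) hne ?_
  · refine DifferentiableOn.mul (a := fun z => ((c : ℂ) * z + D) ^ 3) (by fun_prop) (hu.pow 2)
  intro z hz
  have h0 := hr z hz
  have h1 := TH_sq hd h hdc hD hz
  have h2 := TH_sq he h hec hD hz
  have h3 := TH_sq hf h hfc hD hz
  simp only [Pi.mul_apply, Pi.pow_apply] at h0 ⊢
  calc _ = (u (mob a b c D z) * (TH d z * TH e z * TH f z)) ^ 2 := by ring
    _ = u z ^ 2 * (TH d (mob a b c D z) ^ 2 * TH e (mob a b c D z) ^ 2 * TH f (mob a b c D z) ^ 2) := by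
        rw [h0]; ring
    _ = _ := by rw [h1, h2, h3]; ring

lemma u0_sq (h : a * D - b * c = 1) (hD : D % 4 = 1) (hc : 2016 ∣ c) :
    ∀ z ∈ UU, u0 (mob a b c D z) ^ 2 = (c * z + D) ^ 3 * u0 z ^ 2 := by
  refine sq_of_rel (d := 3) (e := 1) (f := 1) h hD u0_diff (by norm_num) (by norm_num) (by norm_num)
    (by omega) (by omega) (by omega) ?_
  rw [mul_assoc]
  refine Rel.smul _ (Rel.mul (relP1 h hD (by norm_num) (by omega)) (Rel.sub ?_ ?_)) <;>
  exact rel24 h hD (by norm_num) (by norm_num) (by omega) (by omega)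

lemma u1_sq (h : a * D - b * c = 1) (hD : D % 4 = 1) (hc : 2016 ∣ c) :
    ∀ z ∈ UU, u1 (mob a b c D z) ^ 2 = (c * z + D) ^ 3 * u1 z ^ 2 := by
  refine sq_of_rel (d := 6) (e := 21) (f := 168) h hD u1_diff (by norm_num) (by norm_num) (by norm_num)
    (by omega) (by omega) (by omega) ?_
  exact Rel.mul (Rel.mul (relP1 h hD (by norm_num) (by omega)) (relP1 h hD (by norm_num) (by omega)))
    (Rel.refl _)

lemma u2_sq (h : a * D - b * c = 1) (hD : D % 4 = 1) (hc : 2016 ∣ c) :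
    ∀ z ∈ UU, u2 (mob a b c D z) ^ 2 = (c * z + D) ^ 3 * u2 z ^ 2 := by
  refine sq_of_rel (d := 42) (e := 1) (f := 504) h hD u2_diff (by norm_num) (by norm_num) (by norm_num)
    (by omega) (by omega) (by omega) ?_
  rw [mul_assoc]
  refine Rel.mul (relP1 h hD (by norm_num) (by omega)) (Rel.add (Rel.smul _ ?_) ?_)
  · refine Rel.mul ?_ (Rel.refl _)
    exact Rel.trans h (P1_diff (by norm_num)) (TH_diff (by norm_num)) (TH_diff (by norm_num))
      (TH_ne (by norm_num)) (relP1 h hD (by norm_num) (by omega))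
      (rel9 h hD (d := 1) (by norm_num) (by omega))
  · refine Rel.mul (relP3 h hD (by norm_num) (by omega)) ?_
    have h9 := rel9 h hD (d := 56) (by norm_num) (by omega)
    exact Rel.sub h9.symm (Rel.refl _)

/-- the norm over signs -/
noncomputable def GG (z : ℂ) : ℂ :=
  (u0 z - u1 z - u2 z) * (u0 z + u1 z - u2 z) * (u0 z - u1 z + u2 z) * (u0 z + u1 z + u2 z)

lemma GG_diff : DifferentiableOn ℂ GG UU :=
  ((((u0_diff.sub u1_diff).sub u2_diff).mul ((u0_diff.add u1_diff).sub u2_diff)).mul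
    ((u0_diff.sub u1_diff).add u2_diff)).mul ((u0_diff.add u1_diff).add u2_diff)

lemma GG_eq (z : ℂ) : GG z = (u0 z ^ 2) ^ 2 + (u1 z ^ 2) ^ 2 + (u2 z ^ 2) ^ 2
    - 2 * (u0 z ^ 2 * u1 z ^ 2) - 2 * (u0 z ^ 2 * u2 z ^ 2) - 2 * (u1 z ^ 2 * u2 z ^ 2) := by
  unfold GG; ring

lemma GG_mob (h : a * D - b * c = 1) (hc : 2016 ∣ c) (z : ℂ) (hz : z ∈ UU) :
    GG (mob a b c D z) = (c * z + D) ^ 6 * GG z := by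
  have hodd : D % 2 = 1 := by
    obtain ⟨c', rfl⟩ := hc
    have h2 : a * D % 2 = 1 := by
      have : a * D = 2 * (1008 * (b * c')) + 1 := by linarith
      omega
    rcases Int.emod_two_eq_zero_or_one D with h | h
    · rw [Int.mul_emod, h] at h2; simp at h2
    · exact h
  have hD : D % 4 = 1 ∨ (-D) % 4 = 1 := by omega
  rcases hD with hD | hD
  · rw [GG_eq, GG_eq, u0_sq h hD hc z hz, u1_sq h hD hc z hz, u2_sq h hD hc z hz]; ring
  · have e : mob a b c D z = mob (-a) (-b) (-c) (-D) z := by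
      unfold mob
      rw [← neg_div_neg_eq]; push_cast; congr 1 <;> ring
    have h' : (-a) * (-D) - (-b) * (-c) = 1 := by linarith
    have hc' : 2016 ∣ -c := (dvd_neg).mpr hc
    rw [e, GG_eq, GG_eq, u0_sq h' hD hc' z hz, u1_sq h' hD hc' z hz, u2_sq h' hD hc' z hz]
    push_cast; ring

end Thm11

namespace Thm11
open Complex Filter Topology

lemma th_le_two {t : ℂ} (ht : 1 ≤ t.im) : ‖jacobiTheta t‖ ≤ 2 := by
  have h := norm_jacobiTheta_sub_one_le (τ := t) (by linarith)
  have he : Real.exp (-Real.pi * t.im) ≤ 1 / 3 := by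
    have h3 : Real.exp (-3) ≤ 1 / 3 := by
      rw [Real.exp_neg, one_div]
      apply inv_anti₀ (by norm_num)
      have := Real.add_one_le_exp (3 : ℝ)
      linarith
    refine le_trans (Real.exp_le_exp.mpr ?_) h3
    nlinarith [Real.pi_gt_three]
  have hpos := Real.exp_pos (-Real.pi * t.im)
  set x := Real.exp (-Real.pi * t.im)
  have h2 : 2 / (1 - x) * x ≤ 1 := by
    rw [div_mul_eq_mul_div, div_le_one (by linarith)]
    linarith
  calc ‖jacobiTheta t‖ = ‖(jacobiTheta t - 1) + 1‖ := by ring_nf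
    _ ≤ ‖jacobiTheta t - 1‖ + ‖(1 : ℂ)‖ := norm_add_le _ _
    _ ≤ 2 := by rw [norm_one]; linarith

lemma th_le_imag {t : ℂ} (ht : 0 < t.im) : ‖jacobiTheta t‖ ≤ ‖jacobiTheta (t.im * I)‖ := by
  have h1 := hasSum_jacobiTheta₂_term (0 : ℂ) ht
  have h2 := hasSum_jacobiTheta₂_term (0 : ℂ) (τ := t.im * I) (by simpa using ht)
  rw [← jacobiTheta_eq_jacobiTheta₂] at h1 h2
  have e : ∀ n : ℤ, jacobiTheta₂_term n 0 (t.im * I) = ((‖jacobiTheta₂_term n 0 t‖ : ℝ) : ℂ) := by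
    intro n
    rw [norm_jacobiTheta₂_term]
    unfold jacobiTheta₂_term
    push_cast
    congr 1
    simp only [zero_im, mul_zero]
    push_cast
    linear_combination (Real.pi * (n : ℂ) ^ 2 * t.im) * I_sq
  have h3 : HasSum (fun n : ℤ => ((‖jacobiTheta₂_term n 0 t‖ : ℝ) : ℂ)) (jacobiTheta (t.im * I)) :=
    HasSum_congr' h2 e
  have hs : Summable (fun n : ℤ => ‖jacobiTheta₂_term n 0 t‖) := by
    have := h3.summable
    exact_mod_cast this
  have h4 : jacobiTheta (t.im * I) = ((∑' n : ℤ, ‖jacobiTheta₂_term n 0 t‖ : ℝ) : ℂ) := by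
    rw [← h3.tsum_eq]; push_cast; rfl
  rw [h4, ← h1.tsum_eq, norm_real]
  exact (norm_tsum_le_tsum_norm hs).trans (le_abs_self _)

lemma th_bound {t : ℂ} (ht : 0 < t.im) : ‖jacobiTheta t‖ ^ 2 ≤ 4 * (1 + 1 / t.im) := by
  by_cases h1 : 1 ≤ t.im
  · have := th_le_two h1
    have h0 := norm_nonneg (jacobiTheta t)
    have : 0 < 1 / t.im := by positivity
    nlinarith
  · push Not at h1
    have hS := th_S (t.im * I) (by simpa using ht)
    have hne : (t.im : ℂ) ≠ 0 := by exact_mod_cast ht.ne'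
    have e1 : -1 / (t.im * I) = ((1 / t.im : ℝ) : ℂ) * I := by
      push_cast; field_simp; rw [I_sq]
    have e2 : -I * (t.im * I) = t.im := by linear_combination (-t.im : ℂ) * I_sq
    rw [e1, e2] at hS
    have h2 : ‖jacobiTheta (((1 / t.im : ℝ) : ℂ) * I)‖ ≤ 2 := by
      apply th_le_two
      simp only [im_ofReal_mul, I_im, mul_one]
      rw [le_div_iff₀ ht]; linarith
    have h3 := congrArg norm hS
    rw [norm_pow, norm_mul, norm_pow, norm_real, Real.norm_of_nonneg ht.le] at h3
    have h4 := th_le_imag ht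
    have h5 : ‖jacobiTheta t‖ ^ 2 ≤ ‖jacobiTheta (t.im * I)‖ ^ 2 := by gcongr
    have h6 : ‖jacobiTheta (((1 / t.im : ℝ) : ℂ) * I)‖ ^ 2 ≤ 4 := by
      have := norm_nonneg (jacobiTheta (((1 / t.im : ℝ) : ℂ) * I))
      nlinarith
    have h7 : ‖jacobiTheta (t.im * I)‖ ^ 2 ≤ 4 / t.im := by
      rw [le_div_iff₀ ht]; linarith
    have : 4 * (1 + 1 / t.im) = 4 + 4 / t.im := by ring
    linarith

/-- size function -/
noncomputable def ss (z : ℂ) : ℝ := Real.sqrt (1 + 1 / z.im)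

lemma ss_nn (z : ℂ) : 0 ≤ ss z := Real.sqrt_nonneg _

lemma TH_bound {d : ℕ} (hd : 0 < d) {z : ℂ} (hz : z ∈ UU) : ‖TH d z‖ ≤ 2 * ss z := by
  have hz' : 0 < z.im := hz
  have him : (2 * (d * z)).im = 2 * d * z.im := by
    rw [show (2 * (d * z) : ℂ) = ((2 * d : ℝ) : ℂ) * z by push_cast; ring, im_ofReal_mul]
  have hd1 : (1 : ℝ) ≤ d := by exact_mod_cast hd
  have h1 : z.im ≤ (2 * (d * z)).im := by rw [him]; nlinarith
  have h := th_bound (t := 2 * (d * z)) (by linarith)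
  have h2 : 1 / (2 * (d * z)).im ≤ 1 / z.im := one_div_le_one_div_of_le hz' h1
  unfold ss TH ph
  have h3 : ‖jacobiTheta (2 * (d * z))‖ ^ 2 ≤ (2 * Real.sqrt (1 + 1 / z.im)) ^ 2 := by
    rw [mul_pow, Real.sq_sqrt (by positivity)]
    linarith
  exact (pow_le_pow_iff_left₀ (norm_nonneg _) (by positivity) two_ne_zero).mp h3

lemma P1_bound {d : ℕ} (hd : 0 < d) {z : ℂ} (hz : z ∈ UU) : ‖P1 d z‖ ≤ 4 * ss z := by
  have h1 := TH_bound hd hz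
  have h2 := TH_bound (d := 4 * d) (by omega) hz
  refine (norm_sub_le _ _).trans (by linarith)

lemma P2_bound {d : ℕ} (hd : 0 < d) {z : ℂ} (hz : z ∈ UU) : ‖P2 d z‖ ≤ 4 * ss z := by
  have h1 := TH_bound hd hz
  have h2 := TH_bound (d := 9 * d) (by omega) hz
  refine (norm_sub_le _ _).trans (by linarith)

lemma P3_bound {d : ℕ} (hd : 0 < d) {z : ℂ} (hz : z ∈ UU) : ‖P3 d z‖ ≤ 8 * ss z := by
  have h1 := TH_bound hd hz
  have h2 := TH_bound (d := 4 * d) (by omega) hz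
  have h3 := TH_bound (d := 9 * d) (by omega) hz
  have h4 := TH_bound (d := 36 * d) (by omega) hz
  refine (norm_add_le _ _).trans ?_
  have h5 : ‖(TH d - TH (4 * d) - TH (9 * d)) z‖ ≤ ‖TH d z‖ + ‖TH (4 * d) z‖ + ‖TH (9 * d) z‖ :=
    (norm_sub_le _ _).trans (by
      have := norm_sub_le (TH d z) (TH (4 * d) z)
      simp only [Pi.sub_apply]
      linarith)
  linarith

lemma u0_bound {z : ℂ} (hz : z ∈ UU) : ‖u0 z‖ ≤ 16 * ss z ^ 3 := by
  have h1 := P1_bound (d := 3) (by norm_num) hz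
  have h2 := TH_bound (d := 24) (by norm_num) hz
  have h3 := TH_bound (d := 168) (by norm_num) hz
  have e : u0 z = (1 / 2) * (P1 3 z * (TH 24 z * TH 24 z - TH 168 z * TH 168 z)) := rfl
  rw [e, norm_mul, norm_mul]
  have := ss_nn z
  have h4 : ‖TH 24 z * TH 24 z - TH 168 z * TH 168 z‖ ≤ (2 * ss z) * (2 * ss z) + (2 * ss z) * (2 * ss z) := by
    refine (norm_sub_le _ _).trans ?_
    rw [norm_mul, norm_mul]
    gcongr
  have := ss_nn z
  calc ‖(1 / 2 : ℂ)‖ * (‖P1 3 z‖ * ‖TH 24 z * TH 24 z - TH 168 z * TH 168 z‖) ≤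
      (1 / 2) * ((4 * ss z) * ((2 * ss z) * (2 * ss z) + (2 * ss z) * (2 * ss z))) := by
        gcongr
        simp
    _ = 16 * ss z ^ 3 := by ring

lemma u1_bound {z : ℂ} (hz : z ∈ UU) : ‖u1 z‖ ≤ 32 * ss z ^ 3 := by
  have h1 := P1_bound (d := 6) (by norm_num) hz
  have h2 := P1_bound (d := 21) (by norm_num) hz
  have h3 := TH_bound (d := 168) (by norm_num) hz
  have e : u1 z = P1 6 z * P1 21 z * TH 168 z := rfl
  have := ss_nn z
  rw [e, norm_mul, norm_mul]
  calc _ ≤ (4 * ss z) * (4 * ss z) * (2 * ss z) := by gcongr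
    _ = _ := by ring

lemma u2_bound {z : ℂ} (hz : z ∈ UU) : ‖u2 z‖ ≤ 192 * ss z ^ 3 := by
  have h1 := P1_bound (d := 42) (by norm_num) hz
  have h2 := P1_bound (d := 9) (by norm_num) hz
  have h3 := TH_bound (d := 504) (by norm_num) hz
  have h4 := P3_bound (d := 1) (by norm_num) hz
  have h5 := P2_bound (d := 56) (by norm_num) hz
  have e : u2 z = P1 42 z * (2 * (P1 9 z * TH 504 z) + P3 1 z * P2 56 z) := rfl
  have := ss_nn z
  have h6 : ‖2 * (P1 9 z * TH 504 z) + P3 1 z * P2 56 z‖ ≤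
      2 * ((4 * ss z) * (2 * ss z)) + (8 * ss z) * (4 * ss z) := by
    refine (norm_add_le _ _).trans ?_
    rw [norm_mul, norm_mul, norm_mul]
    gcongr
    simp
  rw [e, norm_mul]
  calc _ ≤ (4 * ss z) * (2 * ((4 * ss z) * (2 * ss z)) + (8 * ss z) * (4 * ss z)) := by gcongr
    _ = _ := by ring

lemma GG_bound {z : ℂ} (hz : z ∈ UU) : ‖GG z‖ ≤ 240 ^ 4 * (1 + 1 / z.im) ^ 6 := by
  have h0 := u0_bound hz
  have h1 := u1_bound hz
  have h2 := u2_bound hz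
  have hs := ss_nn z
  have hz' : 0 < z.im := hz
  have hss : ss z ^ 2 = 1 + 1 / z.im := Real.sq_sqrt (by positivity)
  have k : ∀ x y w : ℂ, ‖x‖ ≤ 16 * ss z ^ 3 → ‖y‖ ≤ 32 * ss z ^ 3 → ‖w‖ ≤ 192 * ss z ^ 3 →
      ‖x + y + w‖ ≤ 240 * ss z ^ 3 := by
    intro x y w hx hy hw
    refine (norm_add₃_le).trans (by linarith)
  unfold GG
  rw [norm_mul, norm_mul, norm_mul]
  have a1 := k (u0 z) (-u1 z) (-u2 z) h0 (by rwa [norm_neg]) (by rwa [norm_neg])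
  have a2 := k (u0 z) (u1 z) (-u2 z) h0 h1 (by rwa [norm_neg])
  have a3 := k (u0 z) (-u1 z) (u2 z) h0 (by rwa [norm_neg]) h2
  have a4 := k (u0 z) (u1 z) (u2 z) h0 h1 h2
  simp only [← sub_eq_add_neg] at a1 a2 a3
  calc _ ≤ (240 * ss z ^ 3) * (240 * ss z ^ 3) * (240 * ss z ^ 3) * (240 * ss z ^ 3) := by gcongr
    _ = 240 ^ 4 * (ss z ^ 2) ^ 6 := by ring
    _ = _ := by rw [hss]

lemma mob_im_eq {a b c D : ℤ} (h : a * D - b * c = 1) (z : ℂ) :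
    (mob a b c D z).im = z.im / ‖(c : ℂ) * z + D‖ ^ 2 := by
  have h' : (a : ℝ) * D - b * c = 1 := by exact_mod_cast h
  unfold mob
  rw [div_im, ← normSq_eq_norm_sq]
  rw [← sub_div]
  congr 1
  simp
  linear_combination z.im * h'

lemma GG_bdd_strip {a b c D : ℤ} (h : a * D - b * c = 1) {z : ℂ} (hz : 1 ≤ z.im) (hx : |z.re| ≤ 2016) :
    ‖GG (mob a b c D z)‖ ≤ 240 ^ 4 * (1 + 2017 * |(c : ℝ)| + |(D : ℝ)|) ^ 6 * ‖(c : ℂ) * z + D‖ ^ 6 := by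
  have hzU : z ∈ UU := show 0 < z.im by linarith
  have hb := GG_bound (mob_mem h hzU)
  rw [mob_im_eq h] at hb
  set w : ℂ := (c : ℂ) * z + D with hw
  have hw1 : 1 ≤ ‖w‖ := by
    by_cases hc : c = 0
    · have hD : D = 1 ∨ D = -1 := by
        rw [hc] at h
        exact Int.eq_one_or_neg_one_of_mul_eq_one (by linarith : D * a = 1)
      rcases hD with hD | hD <;> simp [hw, hc, hD]
    · have : 1 ≤ |(c : ℝ)| := by exact_mod_cast Int.one_le_abs hc
      have h2 : |w.im| ≤ ‖w‖ := abs_im_le_norm w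
      have h3 : w.im = c * z.im := by simp [hw]
      rw [h3, abs_mul, abs_of_pos (by linarith : 0 < z.im)] at h2
      nlinarith
  have hw2 : ‖w‖ ≤ (2017 * |(c : ℝ)| + |(D : ℝ)|) * z.im := by
    have h1 : ‖z‖ ≤ |z.re| + |z.im| := norm_le_abs_re_add_abs_im z
    rw [abs_of_pos (by linarith : 0 < z.im)] at h1
    have h2 : ‖w‖ ≤ |(c : ℝ)| * ‖z‖ + |(D : ℝ)| := by
      refine (norm_add_le _ _).trans ?_
      rw [norm_mul, norm_intCast, norm_intCast]
    have h3 : ‖z‖ ≤ 2017 * z.im := by linarith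
    have h4 : |(D : ℝ)| ≤ |(D : ℝ)| * z.im := by nlinarith [abs_nonneg (D : ℝ)]
    have h5 : |(c : ℝ)| * ‖z‖ ≤ |(c : ℝ)| * (2017 * z.im) := by gcongr
    linarith
  refine hb.trans ?_
  rw [mul_assoc, ← mul_pow]
  have hz0 : 0 < z.im := by linarith
  gcongr
  rw [one_div_div, sq, mul_div_assoc]
  have h6 : ‖w‖ / z.im ≤ 2017 * |(c : ℝ)| + |(D : ℝ)| := by rw [div_le_iff₀ hz0]; exact hw2
  have h7 : ‖w‖ * (‖w‖ / z.im) ≤ ‖w‖ * (2017 * |(c : ℝ)| + |(D : ℝ)|) := by gcongr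
  nlinarith

lemma GG_bdd {a b c D : ℤ} (h : a * D - b * c = 1) {z : ℂ} (hz : 1 ≤ z.im) :
    ‖GG (mob a b c D z)‖ ≤ 240 ^ 4 * (1 + 2017 * |(c : ℝ)| + |(D : ℝ)|) ^ 6 * ‖(c : ℂ) * z + D‖ ^ 6 := by
  have hzU : z ∈ UU := show 0 < z.im by linarith
  set n : ℤ := -⌊z.re / 2016⌋ with hn
  set z' : ℂ := z + 2016 * n with hz'
  have him : z'.im = z.im := by simp [hz']
  have hre : |z'.re| ≤ 2016 := by
    have h1 := Int.floor_le (z.re / 2016)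
    have h2 := Int.lt_floor_add_one (z.re / 2016)
    have : z'.re = z.re - 2016 * ⌊z.re / 2016⌋ := by simp [hz', hn]; ring
    rw [this, abs_le]
    constructor <;> linarith
  have hb := GG_bdd_strip h (z := z') (by rw [him]; exact hz) hre
  have hden := den_ne c D (det_nz h) z hzU
  have hden' : (c : ℂ) * z' + D ≠ 0 := den_ne c D (det_nz h) z' (show 0 < z'.im by rw [him]; linarith)
  have hG := GG_mob (a := 1 - 2016 * n * a * c) (b := 2016 * n * a ^ 2) (c := -2016 * n * c ^ 2)
    (D := 1 + 2016 * n * a * c) (by ring) ⟨-n * c ^ 2, by ring⟩ (mob a b c D z) (mob_mem h hzU)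
  have h' : (a : ℂ) * D - b * c = 1 := by exact_mod_cast h
  have e2 : ((-2016 * n * c ^ 2 : ℤ) : ℂ) * mob a b c D z + (1 + 2016 * n * a * c : ℤ) =
      (c * z' + D) / (c * z + D) := by
    unfold mob
    rw [eq_div_iff hden, add_mul, mul_assoc, div_mul_cancel₀ _ hden, hz']
    push_cast
    linear_combination (2016 * n * c : ℂ) * h'
  have e3 : ((1 - 2016 * n * a * c : ℤ) : ℂ) * mob a b c D z + (2016 * n * a ^ 2 : ℤ) =
      (a * z' + b) / (c * z + D) := by
    unfold mob
    rw [eq_div_iff hden, add_mul, mul_assoc, div_mul_cancel₀ _ hden, hz']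
    push_cast
    linear_combination (2016 * n * a : ℂ) * h'
  have e1 : mob (1 - 2016 * n * a * c) (2016 * n * a ^ 2) (-2016 * n * c ^ 2) (1 + 2016 * n * a * c)
      (mob a b c D z) = mob a b c D z' := by
    conv_lhs => rw [mob]
    rw [e2, e3, div_div_div_cancel_right₀ hden]; rfl
  rw [e1, e2] at hG
  rw [hG, norm_mul, norm_pow, norm_div, div_pow] at hb
  have p1 : 0 < ‖(c : ℂ) * z + D‖ ^ 6 := by positivity
  have p2 : 0 < ‖(c : ℂ) * z' + D‖ ^ 6 := by positivity
  rw [div_mul_eq_mul_div, div_le_iff₀ p1] at hb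
  refine le_of_mul_le_mul_left (a := ‖(c : ℂ) * z' + D‖ ^ 6) ?_ p2
  linarith

end Thm11

namespace Thm11
open Complex Filter Topology UpperHalfPlane CongruenceSubgroup ModularForm
open scoped MatrixGroups Manifold

lemma GG_slash (γ : SL(2, ℤ)) (τ : ℍ) : ((fun τ : ℍ => GG τ) ∣[(6 : ℤ)] γ) τ =
    GG (mob (γ 0 0) (γ 0 1) (γ 1 0) (γ 1 1) τ) * ((γ 1 0 : ℂ) * τ + (γ 1 1 : ℂ)) ^ (-6 : ℤ) := by
  rw [ModularForm.SL_slash_apply]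
  congr 2
  · rw [UpperHalfPlane.specialLinearGroup_apply]
    simp [mob]

lemma sl_det (γ : SL(2, ℤ)) : γ 0 0 * γ 1 1 - γ 0 1 * γ 1 0 = 1 := by
  rw [← Matrix.det_fin_two]; exact γ.2

instance : (Gamma0 2016).FiniteIndex := inferInstance

lemma GG_slash_bdd (γ : SL(2, ℤ)) : IsBoundedAtImInfty ((fun τ : ℍ => GG τ) ∣[(6 : ℤ)] γ) := by
  rw [UpperHalfPlane.isBoundedAtImInfty_iff]
  refine ⟨240 ^ 4 * (1 + 2017 * |((γ 1 0 : ℤ) : ℝ)| + |((γ 1 1 : ℤ) : ℝ)|) ^ 6, 1, fun τ hτ => ?_⟩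
  rw [GG_slash, norm_mul]
  have h := GG_bdd (sl_det γ) (z := τ) hτ
  have hden := den_ne (γ 1 0) (γ 1 1) (det_nz (sl_det γ)) τ τ.im_pos
  rw [norm_zpow, zpow_neg, ← div_eq_mul_inv, div_le_iff₀ (by positivity)]
  exact h

/-- the form -/
noncomputable def GM : ModularForm (Gamma0 2016 : Subgroup (GL (Fin 2) ℝ)) 6 where
  toFun := fun τ => GG τ
  slash_action_eq' := by
    rintro _ ⟨γ, hγ, rfl⟩
    ext τ
    have := GG_slash γ τ
    rw [ModularForm.SL_slash] at this
    refine this.trans ?_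
    have hc : 2016 ∣ γ 1 0 := by
      have := Gamma0_mem.mp hγ
      exact (ZMod.intCast_zmod_eq_zero_iff_dvd _ 2016).mp this
    rw [GG_mob (sl_det γ) hc τ τ.im_pos]
    have hden := den_ne (γ 1 0) (γ 1 1) (det_nz (sl_det γ)) τ τ.im_pos
    rw [mul_right_comm, zpow_neg]
    rw [show ((((γ 1 0 : ℤ) : ℂ) * τ + ((γ 1 1 : ℤ) : ℂ)) ^ (6 : ℤ)) = ((((γ 1 0 : ℤ) : ℂ) * τ + ((γ 1 1 : ℤ) : ℂ)) ^ (6 : ℕ)) from zpow_natCast _ 6,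
      mul_inv_cancel₀ (pow_ne_zero _ hden), one_mul]
  holo' := by
    rw [UpperHalfPlane.mdifferentiable_iff]
    refine GG_diff.congr fun z hz => ?_
    simp [Function.comp, UpperHalfPlane.ofComplex_apply_of_im_pos hz]
  bdd_at_cusps' := by
    intro c hc
    rw [Subgroup.IsArithmetic.isCusp_iff_isCusp_SL2Z] at hc
    rw [OnePoint.isBoundedAt_iff_forall_SL2Z hc]
    intro γ _
    exact GG_slash_bdd γ

end Thm11

namespace Thm11
open Complex Filter Topology UpperHalfPlane CongruenceSubgroup ModularForm
open scoped MatrixGroups Manifold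

lemma col_inv (p k : ℕ) (hp : p.Prime) (γ : SL(2, ℤ)) : ∃ x : Bool × ZMod (p ^ k),
    (x.1 = true → ((γ 1 0 : ℤ) : ZMod (p ^ k)) = x.2 * ((γ 0 0 : ℤ) : ZMod (p ^ k))) ∧
    (x.1 = false → ((γ 0 0 : ℤ) : ZMod (p ^ k)) = x.2 * ((γ 1 0 : ℤ) : ZMod (p ^ k))) := by
  have hunit : ∀ x : ℤ, ¬ (p : ℤ) ∣ x → IsUnit ((x : ℤ) : ZMod (p ^ k)) := by
    intro x hx
    rw [ZMod.coe_int_isUnit_iff_isCoprime]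
    push_cast
    exact IsCoprime.pow_left ((Nat.prime_iff_prime_int.mp hp).coprime_iff_not_dvd.mpr hx)
  by_cases ha : (p : ℤ) ∣ γ 0 0
  · have hc : ¬ (p : ℤ) ∣ γ 1 0 := by
      intro hc
      have h := sl_det γ
      have : (p : ℤ) ∣ 1 := by
        rw [← h]; exact dvd_sub (ha.mul_right _) (hc.mul_left _)
      exact (Nat.prime_iff_prime_int.mp hp).not_isUnit (isUnit_of_dvd_one this)
    obtain ⟨u, hu⟩ := hunit _ hc
    refine ⟨(false, ((γ 0 0 : ℤ) : ZMod (p ^ k)) * (u⁻¹ : (ZMod (p ^ k))ˣ)), by simp, fun _ => ?_⟩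
    rw [← hu]; simp [mul_assoc]
  · obtain ⟨u, hu⟩ := hunit _ ha
    refine ⟨(true, ((γ 1 0 : ℤ) : ZMod (p ^ k)) * (u⁻¹ : (ZMod (p ^ k))ˣ)), fun _ => ?_, by simp⟩
    rw [← hu]; simp [mul_assoc]

lemma col_dvd (p k : ℕ) (hp : p.Prime) (γ δ : SL(2, ℤ))
    (h : (col_inv p k hp γ).choose = (col_inv p k hp δ).choose) :
    ((p ^ k : ℕ) : ℤ) ∣ γ 0 0 * δ 1 0 - γ 1 0 * δ 0 0 := by
  have h1 := (col_inv p k hp γ).choose_spec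
  have h2 := (col_inv p k hp δ).choose_spec
  rw [← h] at h2
  set x := (col_inv p k hp γ).choose
  rw [← ZMod.intCast_zmod_eq_zero_iff_dvd]
  push_cast
  cases hx : x.1
  · rw [h1.2 hx, h2.2 hx]; ring
  · rw [h1.1 hx, h2.1 hx]; ring

lemma index_le : (Gamma0 2016).index ≤ 16128 := by
  have p2 : Nat.Prime 2 := by norm_num
  have p3 : Nat.Prime 3 := by norm_num
  have p7 : Nat.Prime 7 := by norm_num
  let F : SL(2, ℤ) ⧸ Gamma0 2016 → (Bool × ZMod (2 ^ 5)) × (Bool × ZMod (3 ^ 2)) × (Bool × ZMod (7 ^ 1)) :=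
    fun q => ((col_inv 2 5 p2 q.out).choose, (col_inv 3 2 p3 q.out).choose, (col_inv 7 1 p7 q.out).choose)
  have hF : Function.Injective F := by
    intro q r hqr
    simp only [F, Prod.mk.injEq] at hqr
    have d2 := col_dvd 2 5 p2 _ _ hqr.1
    have d3 := col_dvd 3 2 p3 _ _ hqr.2.1
    have d7 := col_dvd 7 1 p7 _ _ hqr.2.2
    have : q.out⁻¹ * r.out ∈ Gamma0 2016 := by
      rw [Gamma0_mem]
      refine (ZMod.intCast_zmod_eq_zero_iff_dvd _ 2016).mpr ?_
      have e : (q.out⁻¹ * r.out) 1 0 = q.out 0 0 * r.out 1 0 - q.out 1 0 * r.out 0 0 := by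
        rw [Matrix.SpecialLinearGroup.coe_mul, Matrix.SpecialLinearGroup.coe_inv,
          Matrix.adjugate_fin_two]
        simp [Matrix.mul_apply, Fin.sum_univ_two]
        ring
      rw [e]
      norm_num at d2 d3 d7
      push_cast
      omega
    rw [← QuotientGroup.out_eq' q, ← QuotientGroup.out_eq' r]
    exact QuotientGroup.eq.mpr this
  have hc := Nat.card_le_card_of_injective F hF
  rw [Subgroup.index_eq_card]
  refine hc.trans (le_of_eq ?_)
  simp [Nat.card_prod, Nat.card_eq_fintype_card, ZMod.card]

lemma coeff_zero_of_decay {k : ℤ} (f : ModularForm 𝒮ℒ k) (M : ℕ) (C : ℝ)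
    (h : ∀ᶠ τ : ℍ in atImInfty, ‖f τ‖ ≤ C * Real.exp (-2 * Real.pi * M * τ.im)) (n : ℕ) (hn : n < M) :
    (qExpansion 1 f).coeff n = 0 := by
  have hp : (1 : ℝ) ∈ (𝒮ℒ : Subgroup (GL (Fin 2) ℝ)).strictPeriods := by simp
  have : Fact (IsCusp OnePoint.infty (𝒮ℒ : Subgroup (GL (Fin 2) ℝ))) :=
    ⟨Subgroup.isCusp_of_mem_strictPeriods one_pos hp⟩
  obtain ⟨A, hA⟩ := (atImInfty_mem _).mp h
  have key : ∀ t : ℝ, max A 1 ≤ t → ‖(qExpansion 1 f).coeff n‖ ≤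
      C * Real.exp (-2 * Real.pi * (M - n) * t) := by
    intro t ht
    have ht0 : 0 < t := by linarith [le_max_right A 1]
    have hi := UpperHalfPlane.qExpansion_coeff_eq_intervalIntegral one_pos
      (SlashInvariantFormClass.periodic_comp_ofComplex f hp) (ModularFormClass.holo f)
      (ModularFormClass.bdd_at_infty f) n ht0
    rw [hi]
    rw [show (1 : ℂ) / ((1 : ℝ) : ℂ) = 1 by simp, one_mul]
    refine (intervalIntegral.norm_integral_le_of_norm_le_const
      (C := C * Real.exp (-2 * Real.pi * (M - n) * t)) ?_).trans (by simp)
    intro x _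
    have hb : ‖f ⟨x + t * (UpperHalfPlane.I : ℂ), by simpa using ht0⟩‖ ≤ C * Real.exp (-2 * Real.pi * M * t) := by
      have := hA ⟨x + t * (UpperHalfPlane.I : ℂ), by simpa using ht0⟩ (by
        show A ≤ ((x : ℂ) + t * (UpperHalfPlane.I : ℂ)).im
        simp; linarith [le_max_left A 1])
      have e : (⟨(x : ℂ) + t * (UpperHalfPlane.I : ℂ), by simpa using ht0⟩ : ℍ).im = t := by
        show ((x : ℂ) + t * (UpperHalfPlane.I : ℂ)).im = t
        simp
      simpa [e] using this
    rw [norm_mul, norm_div, norm_one, norm_pow, Function.Periodic.norm_qParam]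
    have e : ((x : ℂ) + t * (UpperHalfPlane.I : ℂ)).im = t := by simp
    rw [e, ← Real.exp_nat_mul, one_div, ← Real.exp_neg]
    calc _ ≤ Real.exp (-(n * (-2 * Real.pi * t / 1))) * (C * Real.exp (-2 * Real.pi * M * t)) := by gcongr
      _ = C * (Real.exp (-(n * (-2 * Real.pi * t / 1))) * Real.exp (-2 * Real.pi * M * t)) := by ring
      _ = _ := by rw [← Real.exp_add]; congr 2; ring
  have hlim : Tendsto (fun t : ℝ => C * Real.exp (-2 * Real.pi * (M - n) * t)) atTop (𝓝 (C * 0)) := by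
    refine Tendsto.const_mul _ (Real.tendsto_exp_atBot.comp ?_)
    refine tendsto_id.const_mul_atTop_of_neg ?_
    have : (n : ℝ) < M := by exact_mod_cast hn
    have := mul_pos Real.pi_pos (sub_pos.mpr this)
    linarith
  have := ge_of_tendsto hlim (eventually_atTop.mpr ⟨_, key⟩)
  rw [mul_zero] at this
  exact norm_le_zero_iff.mp this

lemma GG_zero (C : ℝ)
    (h : ∀ z : ℂ, 1 ≤ z.im → ‖GG z‖ ≤ C * Real.exp (-2 * Real.pi * 8065 * z.im)) :
    ∀ z ∈ UU, GG z = 0 := by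
  suffices hG : (GM : ℍ → ℂ) = 0 by
    intro z hz
    exact congrFun hG ⟨z, hz⟩
  rw [← ModularForm.norm_eq_zero_iff (ℋ := 𝒮ℒ)]
  have hO : (ModularForm.norm 𝒮ℒ GM : ℍ → ℂ) =O[atImInfty] (fun τ : ℍ => GG τ) := by
    rw [ModularForm.coe_norm]
    let := Fintype.ofFinite (𝒮ℒ ⧸ ((Gamma0 2016 : Subgroup (GL (Fin 2) ℝ)).subgroupOf 𝒮ℒ))
    classical
    have e : (fun τ : ℍ => GG τ) = fun τ : ℍ => GG τ * ∏ q ∈ Finset.univ.erase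
        (⟦1⟧ : 𝒮ℒ ⧸ ((Gamma0 2016 : Subgroup (GL (Fin 2) ℝ)).subgroupOf 𝒮ℒ)), (1 : ℂ) := by simp
    rw [e]
    have hm := Finset.mul_prod_erase Finset.univ (fun q => SlashInvariantForm.quotientFunc GM q)
      (Finset.mem_univ (⟦1⟧ : 𝒮ℒ ⧸ ((Gamma0 2016 : Subgroup (GL (Fin 2) ℝ)).subgroupOf 𝒮ℒ)))
    refine Asymptotics.IsBigO.congr_left (f₁ := SlashInvariantForm.quotientFunc GM (⟦1⟧ : 𝒮ℒ ⧸ ((Gamma0 2016 : Subgroup (GL (Fin 2) ℝ)).subgroupOf 𝒮ℒ)) *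
      ∏ q ∈ Finset.univ.erase
        (⟦1⟧ : 𝒮ℒ ⧸ ((Gamma0 2016 : Subgroup (GL (Fin 2) ℝ)).subgroupOf 𝒮ℒ)), SlashInvariantForm.quotientFunc GM q) ?_ (fun τ => by
        convert congrFun hm τ)
    refine Asymptotics.IsBigO.mul ?_ ?_
    · rw [SlashInvariantForm.quotientFunc_mk]
      simp
      exact Asymptotics.isBigO_refl _ _
    · rw [Finset.prod_fn]
      refine Asymptotics.IsBigO.finsetProd ?_
      refine Quotient.forall.mpr ?_
      rintro ⟨_, γ, rfl⟩ _
      have := GG_slash_bdd γ⁻¹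
      rw [ModularForm.SL_slash] at this
      rw [SlashInvariantForm.quotientFunc_mk]
      simp only [map_inv] at this
      exact this.trans (Asymptotics.isBigO_const_const _ one_ne_zero _)
  obtain ⟨K, hK⟩ := hO.bound
  have hev : ∀ᶠ τ : ℍ in atImInfty, ‖(ModularForm.norm 𝒮ℒ GM) τ‖ ≤
      (|K| * C) * Real.exp (-2 * Real.pi * (8065 : ℕ) * τ.im) := by
    filter_upwards [hK, (atImInfty_mem {τ : ℍ | 1 ≤ τ.im}).mpr ⟨1, fun z hz => hz⟩] with τ h1 h2
    have h3 := h τ h2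
    calc _ ≤ K * ‖GG τ‖ := h1
      _ ≤ |K| * ‖GG τ‖ := by gcongr; exact le_abs_self K
      _ ≤ |K| * (C * Real.exp (-2 * Real.pi * 8065 * (τ : ℂ).im)) := by gcongr
      _ = _ := by rw [UpperHalfPlane.coe_im]; push_cast; ring
  have hcoef := coeff_zero_of_decay _ _ _ hev
  apply ModularForm.sturm_bound_levelOne
  have hcard : Nat.card (𝒮ℒ ⧸ ((Gamma0 2016 : Subgroup (GL (Fin 2) ℝ)).subgroupOf 𝒮ℒ)) ≤ 16128 := by
    have h1 : ((Gamma0 2016 : Subgroup (GL (Fin 2) ℝ)).comap (Matrix.SpecialLinearGroup.mapGL ℝ : SL(2, ℤ) →* GL (Fin 2) ℝ)).index =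
        Nat.card (𝒮ℒ ⧸ ((Gamma0 2016 : Subgroup (GL (Fin 2) ℝ)).subgroupOf 𝒮ℒ)) := by
      rw [Subgroup.index_comap]; rfl
    rw [← h1, Subgroup.comap_map_eq_self_of_injective Matrix.SpecialLinearGroup.mapGL_injective]
    exact index_le
  have hdiv : (6 * (Nat.card (𝒮ℒ ⧸ ((Gamma0 2016 : Subgroup (GL (Fin 2) ℝ)).subgroupOf 𝒮ℒ)) : ℤ)).toNat / 12
      ≤ 8064 := by omega
  refine lt_of_le_of_lt (Nat.cast_le.mpr hdiv) ?_
  refine lt_of_lt_of_le (b := ((8065 : ℕ) : ℕ∞)) (by norm_cast) ?_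
  exact PowerSeries.nat_le_order _ _ fun i hi => hcoef i hi

end Thm11

namespace Thm11
open Complex Filter Topology

/-- evaluation -/
def Ev (A : PowerSeries ℤ) (x v : ℂ) : Prop :=
  HasSum (fun n : ℕ => ((PowerSeries.coeff n A : ℤ) : ℂ) * x ^ n) v

lemma Ev.add {A B : PowerSeries ℤ} {x a b : ℂ} (h : Ev A x a) (k : Ev B x b) : Ev (A + B) x (a + b) := by
  unfold Ev at *
  refine (HasSum.add h k).congr_fun ?_
  intro n; simp; ring

lemma Ev.neg {A : PowerSeries ℤ} {x a : ℂ} (h : Ev A x a) : Ev (-A) x (-a) := by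
  unfold Ev at *
  refine (HasSum.neg h).congr_fun ?_
  intro n; simp

lemma Ev.sub {A B : PowerSeries ℤ} {x a b : ℂ} (h : Ev A x a) (k : Ev B x b) : Ev (A - B) x (a - b) := by
  rw [sub_eq_add_neg, sub_eq_add_neg]; exact h.add k.neg

lemma Ev.mul {A B : PowerSeries ℤ} {x a b : ℂ} (h : Ev A x a) (k : Ev B x b) : Ev (A * B) x (a * b) := by
  unfold Ev at *
  have hn := h.summable.norm
  have kn := k.summable.norm
  have e := tsum_mul_tsum_eq_tsum_sum_antidiagonal_of_summable_norm hn kn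
  have sm := (summable_norm_sum_mul_antidiagonal_of_summable_norm hn kn).of_norm
  rw [h.tsum_eq, k.tsum_eq] at e
  rw [e]
  refine sm.hasSum.congr_fun ?_
  intro n
  rw [PowerSeries.coeff_mul]
  push_cast
  rw [Finset.sum_mul]
  refine Finset.sum_congr rfl fun p hp => ?_
  rw [← Finset.HasAntidiagonal.mem_antidiagonal.mp hp, pow_add]; ring

lemma Ev.X (x : ℂ) : Ev PowerSeries.X x x := by
  unfold Ev
  have := hasSum_single (f := fun n : ℕ => ((PowerSeries.coeff n (PowerSeries.X : PowerSeries ℤ) : ℤ) : ℂ) * x ^ n) 1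
    (by intro n hn; simp [PowerSeries.coeff_X, hn])
  simpa using this

lemma Ev.C (c : ℤ) (x : ℂ) : Ev (PowerSeries.C c) x c := by
  unfold Ev
  have := hasSum_single (f := fun n : ℕ => ((PowerSeries.coeff n (PowerSeries.C c : PowerSeries ℤ) : ℤ) : ℂ) * x ^ n) 0
    (by intro n hn; rw [PowerSeries.coeff_C, if_neg hn]; simp)
  simpa using this

lemma Ev.theta {A : PowerSeries ℤ} {x v : ℂ} {ι : Type} (E : ι → ℕ)
    (hA : ∀ n, PowerSeries.coeff n A = (Nat.card {i // E i = n} : ℤ))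
    (h : HasSum (fun i => x ^ E i) v) : Ev A x v := by
  unfold Ev
  have h2 := (Equiv.sigmaFiberEquiv E).hasSum_iff.mpr h
  have := h2.sigma (g := fun n => ∑' i : {i // E i = n}, x ^ E i.1) (fun n => (h2.summable.sigma_factor n).hasSum)
  refine this.congr_fun ?_
  intro n
  rw [hA]
  have : ∀ i : {i // E i = n}, x ^ E i.1 = x ^ n := fun i => by rw [i.2]
  simp only [this, tsum_const]
  simp

/-- nome -/
noncomputable def sv (z : ℂ) : ℂ := cexp (2 * Real.pi * I * z)

lemma TH_hasSum {d : ℕ} (hd : 0 < d) {z : ℂ} (hz : z ∈ UU) :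
    HasSum (fun n : ℤ => sv z ^ (d * n.natAbs ^ 2)) (TH d z) := by
  refine HasSum_congr' (ph_hasSum _ (smul_mem hd hz)) ?_
  intro n
  unfold sv
  rw [← Complex.exp_nat_mul]
  congr 1
  have : ((n.natAbs ^ 2 : ℕ) : ℂ) = (n : ℂ) ^ 2 := by
    have : ((n.natAbs ^ 2 : ℕ) : ℤ) = n ^ 2 := by push_cast; simp
    rw [← Int.cast_pow, ← this, Int.cast_natCast]
  rw [Nat.cast_mul, this]; ring

lemma TH_ind {d : ℕ} (hd : 0 < d) (k : ℕ) (hk : 0 < k) {z : ℂ} (hz : z ∈ UU) :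
    HasSum (fun n : ℤ => if (k : ℤ) ∣ n then sv z ^ (d * n.natAbs ^ 2) else 0) (TH (k ^ 2 * d) z) := by
  have hi : Function.Injective (fun n : ℤ => (k : ℤ) * n) := by
    intro a b h
    exact mul_left_cancel₀ (by positivity) h
  rw [← hi.hasSum_iff]
  · refine HasSum_congr' (TH_hasSum (by positivity) hz) ?_
    intro n
    simp [Int.natAbs_mul]
    congr 1; ring
  · intro n hn
    rw [if_neg]
    rintro ⟨m, rfl⟩
    exact hn ⟨m, rfl⟩

lemma half_sum {ι : Type} {f : ℤ → ℂ} {v : ℂ} (χ : ℤ → Prop) [DecidablePred χ] (g : ι → ℤ)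
    (hg : Function.Injective g) (hf : ∀ n, f (-n) = f n)
    (h1 : ∀ i, χ (g i)) (h2 : ∀ i, χ (-g i)) (h3 : ∀ n, χ n → ∃ i, n = g i ∨ n = -g i)
    (h4 : ∀ i j, g i ≠ -g j) (h : HasSum (fun n => if χ n then f n else 0) v) :
    HasSum (fun i => f (g i)) (v / 2) := by
  have hinj : Function.Injective (Sum.elim g (fun i => -g i)) := by
    refine hg.sumElim (fun a b hab => hg (neg_injective hab)) ?_
    intro a b; exact h4 a b
  rw [← hinj.hasSum_iff] at h
  · have hs : Summable (fun i => f (g i)) := by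
      have := h.summable.comp_injective (Sum.inl_injective (α := ι) (β := ι))
      refine this.congr ?_
      intro i; simp [h1]
    have hw := hs.hasSum
    have := HasSum.sum (f := (fun n => if χ n then f n else 0) ∘ Sum.elim g (fun i => -g i))
      (a := ∑' i, f (g i)) (b := ∑' i, f (g i)) (by simpa [Function.comp_def, h1] using hw)
      (by simpa [Function.comp_def, h2, hf] using hw)
    have e := this.unique h
    rw [← e]
    convert hw using 1; ring
  · intro n hn
    rw [if_neg]
    intro hc
    obtain ⟨i, rfl | rfl⟩ := h3 n hc
    · exact hn ⟨Sum.inl i, rfl⟩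
    · exact hn ⟨Sum.inr i, rfl⟩

end Thm11

namespace Thm11
open Complex Filter Topology

lemma sv_ne (z : ℂ) : sv z ≠ 0 := Complex.exp_ne_zero _

lemma shift_sum {ι : Type} {s v : ℂ} (hs : s ≠ 0) {e E : ι → ℕ} (d : ℕ)
    (he : ∀ i, e i = d + 24 * E i) (h : HasSum (fun i => s ^ e i) v) :
    HasSum (fun i => (s ^ 24) ^ E i) (v / s ^ d) := by
  refine (h.div_const (s ^ d)).congr_fun ?_
  intro i
  rw [he, pow_add, pow_mul]
  field_simp

lemma ev_phi {k : ℕ} (hk : 0 < k) {z : ℂ} (hz : z ∈ UU) : Ev (phi k) (sv z ^ 24) (TH (24 * k) z) := by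
  refine Ev.theta (ι := ℤ) (fun m => k * m.natAbs ^ 2) ?_ ?_
  · intro n
    unfold phi
    rw [PowerSeries.coeff_mk]
    congr 1
    refine congrArg Set.ncard (Set.ext fun m => ?_)
    simp only [Set.mem_setOf_eq]
    rw [← Int.natAbs_sq m]
    constructor
    · intro h; exact_mod_cast h.symm
    · intro h; exact_mod_cast h.symm
  · have := shift_sum (sv_ne z) 0 (E := fun m : ℤ => k * m.natAbs ^ 2) (fun m => by ring)
      (TH_hasSum (d := 24 * k) (by positivity) hz)
    simpa using this

lemma ev_psi {k : ℕ} (hk : 0 < k) {z : ℂ} (hz : z ∈ UU) :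
    Ev (psi k) (sv z ^ 24) (P1 (3 * k) z / 2 / sv z ^ (3 * k)) := by
  refine Ev.theta (ι := {m : ℤ // 0 ≤ m}) (fun m => k * (m.1 * (m.1 + 1) / 2).toNat) ?_ ?_
  · intro n
    unfold psi
    rw [PowerSeries.coeff_mk]
    congr 1
    refine (Nat.card_congr (Equiv.subtypeSubtypeEquivSubtypeInter (fun m : ℤ => 0 ≤ m)
      (fun m : ℤ => k * (m * (m + 1) / 2).toNat = n))).symm ▸ ?_
    refine congrArg Set.ncard (Set.ext fun m => ?_)
    simp only [Set.mem_setOf_eq]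
    refine and_congr_right fun hm => ?_
    have : 0 ≤ m * (m + 1) / 2 := Int.ediv_nonneg (by positivity) (by norm_num)
    have e : ((m * (m + 1) / 2).toNat : ℤ) = m * (m + 1) / 2 := Int.toNat_of_nonneg this
    rw [← e]
    show _ ↔ _ = _
    constructor
    · intro h; exact_mod_cast h.symm
    · intro h; exact_mod_cast h.symm
  · refine shift_sum (sv_ne z) (3 * k) (e := fun m : {m : ℤ // 0 ≤ m} => 3 * k * (2 * m.1 + 1).natAbs ^ 2) ?_ ?_
    · rintro ⟨m, hm⟩
      have : 0 ≤ m * (m + 1) / 2 := Int.ediv_nonneg (by positivity) (by norm_num)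
      have e : ((m * (m + 1) / 2).toNat : ℤ) = m * (m + 1) / 2 := Int.toNat_of_nonneg this
      have e2 : m * (m + 1) / 2 * 2 = m * (m + 1) := Int.ediv_mul_cancel (Int.even_mul_succ_self m).two_dvd
      zify
      rw [sq_abs, e]
      linear_combination (-12 * k : ℤ) * e2
    · refine half_sum (f := fun n : ℤ => sv z ^ (3 * k * n.natAbs ^ 2)) (fun n : ℤ => ¬ 2 ∣ n)
        (fun m : {m : ℤ // 0 ≤ m} => 2 * m.1 + 1) ?_ ?_ ?_ ?_ ?_ ?_ ?_
      · rintro ⟨a, ha⟩ ⟨b, hb⟩ h; simp only [Subtype.mk.injEq] at *; omega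
      · intro n; simp
      · intro i; omega
      · intro i; omega
      · intro n hn
        rcases le_or_gt 0 n with h | h
        · exact ⟨⟨(n - 1) / 2, by omega⟩, Or.inl (by dsimp only; omega)⟩
        · exact ⟨⟨(-n - 1) / 2, by omega⟩, Or.inr (by dsimp only; omega)⟩
      · rintro ⟨a, ha⟩ ⟨b, hb⟩; dsimp only; omega
      · have h1 := TH_hasSum (d := 3 * k) (by positivity) hz
        have h2 := TH_ind (d := 3 * k) (by positivity) 2 (by norm_num) hz
        refine HasSum_congr' (h1.sub h2) ?_
        intro n
        by_cases h : (2 : ℤ) ∣ n <;> simp [h]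

lemma ev_fA {z : ℂ} (hz : z ∈ UU) :
    Ev (fA 1) (sv z ^ 24) (P3 1 z / 2 / sv z ^ 1) := by
  have nn : ∀ m : ℤ, 0 ≤ m * (3 * m + 1) := by
    intro m
    rcases le_or_gt 0 m with h | h
    · positivity
    · nlinarith
  refine Ev.theta (ι := ℤ) (fun m => 1 * (m * (3 * m + 1) / 2).toNat) ?_ ?_
  · intro n
    unfold fA
    rw [PowerSeries.coeff_mk]
    congr 1
    refine congrArg Set.ncard (Set.ext fun m => ?_)
    simp only [Set.mem_setOf_eq]
    have : 0 ≤ m * (3 * m + 1) / 2 := Int.ediv_nonneg (nn m) (by norm_num)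
    have e : ((m * (3 * m + 1) / 2).toNat : ℤ) = m * (3 * m + 1) / 2 := Int.toNat_of_nonneg this
    rw [← e]
    show _ ↔ _ = _
    constructor
    · intro h; exact_mod_cast h.symm
    · intro h; exact_mod_cast h.symm
  · refine shift_sum (sv_ne z) 1 (e := fun m : ℤ => 1 * (6 * m + 1).natAbs ^ 2) ?_ ?_
    · intro m
      have : 0 ≤ m * (3 * m + 1) / 2 := Int.ediv_nonneg (nn m) (by norm_num)
      have e : ((m * (3 * m + 1) / 2).toNat : ℤ) = m * (3 * m + 1) / 2 := Int.toNat_of_nonneg this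
      have e2 : m * (3 * m + 1) / 2 * 2 = m * (3 * m + 1) := Int.ediv_mul_cancel (by
        rcases Int.even_or_odd' m with ⟨c, rfl | rfl⟩
        · exact ⟨c * (3 * (2 * c) + 1), by ring⟩
        · exact ⟨(2 * c + 1) * (3 * c + 2), by ring⟩)
      zify
      rw [sq_abs, e]
      linear_combination (-12 : ℤ) * e2
    · refine half_sum (f := fun n : ℤ => sv z ^ (1 * n.natAbs ^ 2)) (fun n : ℤ => ¬ 2 ∣ n ∧ ¬ 3 ∣ n)
        (fun m : ℤ => 6 * m + 1) ?_ ?_ ?_ ?_ ?_ ?_ ?_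
      · intro a b h; simp only at h; omega
      · intro n; simp
      · intro i; omega
      · intro i; omega
      · intro n hn
        rcases (show n % 6 = 1 ∨ n % 6 = 5 by omega) with h | h
        · exact ⟨n / 6, Or.inl (by omega)⟩
        · exact ⟨(-n) / 6, Or.inr (by omega)⟩
      · intro a b; omega
      · have h1 := TH_hasSum (d := 1) (by positivity) hz
        have h2 := TH_ind (d := 1) (by positivity) 2 (by norm_num) hz
        have h3 := TH_ind (d := 1) (by positivity) 3 (by norm_num) hz
        have h6 := TH_ind (d := 1) (by positivity) 6 (by norm_num) hz
        refine HasSum_congr' (((h1.sub h2).sub h3).add h6) ?_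
        intro n
        have e6 : ((6 : ℕ) : ℤ) ∣ n ↔ (2 : ℤ) ∣ n ∧ (3 : ℤ) ∣ n := by omega
        simp only [e6]
        by_cases h : (2 : ℤ) ∣ n <;> by_cases h' : (3 : ℤ) ∣ n <;> simp [h, h']

lemma ev_fB {z : ℂ} (hz : z ∈ UU) :
    Ev (fB 7) (sv z ^ 24) (P2 56 z / 2 / sv z ^ 56) := by
  have nn : ∀ m : ℤ, 0 ≤ m * (3 * m + 2) := by
    intro m
    rcases le_or_gt 0 m with h | h
    · positivity
    · nlinarith
  refine Ev.theta (ι := ℤ) (fun m => 7 * (m * (3 * m + 2)).toNat) ?_ ?_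
  · intro n
    unfold fB
    rw [PowerSeries.coeff_mk]
    congr 1
    refine congrArg Set.ncard (Set.ext fun m => ?_)
    simp only [Set.mem_setOf_eq]
    have e : ((m * (3 * m + 2)).toNat : ℤ) = m * (3 * m + 2) := Int.toNat_of_nonneg (nn m)
    rw [← e]
    show _ ↔ _ = _
    constructor
    · intro h; exact_mod_cast h.symm
    · intro h; exact_mod_cast h.symm
  · refine shift_sum (sv_ne z) 56 (e := fun m : ℤ => 56 * (3 * m + 1).natAbs ^ 2) ?_ ?_
    · intro m
      have e : ((m * (3 * m + 2)).toNat : ℤ) = m * (3 * m + 2) := Int.toNat_of_nonneg (nn m)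
      zify
      rw [sq_abs, e]
      ring
    · refine half_sum (f := fun n : ℤ => sv z ^ (56 * n.natAbs ^ 2)) (fun n : ℤ => ¬ 3 ∣ n)
        (fun m : ℤ => 3 * m + 1) ?_ ?_ ?_ ?_ ?_ ?_ ?_
      · intro a b h; simp only at h; omega
      · intro n; simp
      · intro i; omega
      · intro i; omega
      · intro n hn
        rcases (show n % 3 = 1 ∨ n % 3 = 2 by omega) with h | h
        · exact ⟨n / 3, Or.inl (by omega)⟩
        · exact ⟨(-n) / 3, Or.inr (by omega)⟩
      · intro a b; omega
      · have h1 := TH_hasSum (d := 56) (by positivity) hz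
        have h3 := TH_ind (d := 56) (by positivity) 3 (by norm_num) hz
        refine HasSum_congr' (h1.sub h3) ?_
        intro n
        by_cases h' : (3 : ℤ) ∣ n <;> simp [h']

/-- formal series -/
noncomputable def A0 : PowerSeries ℤ := psi 1 * (phi 1 ^ 2 - phi 7 ^ 2)
/-- formal series -/
noncomputable def A1 : PowerSeries ℤ := 4 * PowerSeries.X * psi 2 * psi 7 * phi 7
/-- formal series -/
noncomputable def A2 : PowerSeries ℤ := 8 * PowerSeries.X ^ 2 * psi 14 * psi 3 * phi 21
        + 8 * PowerSeries.X ^ 4 * psi 14 * fA 1 * fB 7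

lemma Ev.congr {A : PowerSeries ℤ} {x a b : ℂ} (h : Ev A x a) (e : a = b) : Ev A x b := e ▸ h

lemma Ev.num (c : ℕ) [c.AtLeastTwo] (x : ℂ) : Ev (OfNat.ofNat c : PowerSeries ℤ) x (OfNat.ofNat c : ℂ) := by
  have := Ev.C (OfNat.ofNat c : ℤ) x
  simpa using this

lemma Ev.sq {A : PowerSeries ℤ} {x a : ℂ} (h : Ev A x a) : Ev (A ^ 2) x (a ^ 2) := by
  rw [pow_two, pow_two]; exact h.mul h

lemma ev_A0 {z : ℂ} (hz : z ∈ UU) : Ev A0 (sv z ^ 24) (u0 z / sv z ^ 3) := by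
  refine ((ev_psi (k := 1) (by norm_num) hz).mul
    ((ev_phi (k := 1) (by norm_num) hz).sq.sub (ev_phi (k := 7) (by norm_num) hz).sq)).congr ?_
  have e : u0 z = (1 / 2) * (P1 3 z * (TH 24 z * TH 24 z - TH 168 z * TH 168 z)) := rfl
  rw [e]
  norm_num
  ring

lemma ev_A1 {z : ℂ} (hz : z ∈ UU) : Ev A1 (sv z ^ 24) (u1 z / sv z ^ 3) := by
  refine (((((Ev.num 4 _).mul (Ev.X _)).mul (ev_psi (k := 2) (by norm_num) hz)).mul
    (ev_psi (k := 7) (by norm_num) hz)).mul (ev_phi (k := 7) (by norm_num) hz)).congr ?_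
  have e : u1 z = P1 6 z * P1 21 z * TH 168 z := rfl
  rw [e]
  norm_num
  have := sv_ne z
  field_simp
  ring

lemma ev_A2 {z : ℂ} (hz : z ∈ UU) : Ev A2 (sv z ^ 24) (u2 z / sv z ^ 3) := by
  have h2 := (Ev.X (sv z ^ 24)).sq
  have h4 := h2.sq
  rw [← pow_mul] at h4
  refine (((((Ev.num 8 _).mul h2).mul (ev_psi (k := 14) (by norm_num) hz)).mul
    (ev_psi (k := 3) (by norm_num) hz)).mul (ev_phi (k := 21) (by norm_num) hz)
    |>.add (((((Ev.num 8 _).mul h4).mul (ev_psi (k := 14) (by norm_num) hz)).mul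
    (ev_fA hz)).mul (ev_fB hz))).congr ?_
  have e : u2 z = P1 42 z * (2 * (P1 9 z * TH 504 z) + P3 1 z * P2 56 z) := rfl
  rw [e]
  norm_num
  have := sv_ne z
  field_simp
  ring

end Thm11

namespace Thm11
open Complex Filter Topology

lemma sv_norm (z : ℂ) : ‖sv z‖ = Real.exp (-2 * Real.pi * z.im) := by
  unfold sv
  rw [Complex.norm_exp]
  congr 1
  simp

lemma one_mem_UU : I ∈ UU := by show 0 < I.im; simp

lemma mem_UU_of {z : ℂ} (h : 1 ≤ z.im) : z ∈ UU := by show 0 < z.im; linarith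

lemma decay {F : PowerSeries ℤ} (N : ℕ) (hF : ∀ n < N, PowerSeries.coeff n F = 0) {v : ℂ → ℂ}
    (hv : ∀ z ∈ UU, Ev F (sv z ^ 24) (v z)) :
    ∃ C : ℝ, 0 ≤ C ∧ ∀ z : ℂ, 1 ≤ z.im → ‖v z‖ ≤ C * (‖sv z‖ ^ 24) ^ N := by
  have hs : Summable (fun n : ℕ => ‖((PowerSeries.coeff n F : ℤ) : ℂ) * (sv I ^ 24) ^ n‖) :=
    (hv I one_mem_UU).summable.norm
  set r0 : ℝ := ‖sv I‖ ^ 24 with hr0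
  have hr : 0 < r0 := by
    have := norm_pos_iff.mpr (sv_ne I)
    positivity
  refine ⟨(∑' n : ℕ, ‖((PowerSeries.coeff n F : ℤ) : ℂ) * (sv I ^ 24) ^ n‖) / r0 ^ N, ?_, ?_⟩
  · exact div_nonneg (tsum_nonneg fun n => norm_nonneg _) (by positivity)
  · intro z hz
    have hb := ((hs.hasSum.div_const (r0 ^ N)).mul_right ((‖sv z‖ ^ 24) ^ N))
    refine (hv z (mem_UU_of hz)).norm_le_of_bounded hb ?_
    intro n
    rcases lt_or_ge n N with h | h
    · rw [hF n h]; simp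
    · obtain ⟨m, rfl⟩ := Nat.exists_eq_add_of_le h
      simp only [norm_mul, norm_pow]
      rw [← hr0]
      have hle : ‖sv z‖ ^ 24 ≤ r0 := by
        rw [hr0]
        gcongr
        rw [sv_norm, sv_norm]
        gcongr 1
        have := Real.pi_pos
        simp
        nlinarith
      rw [pow_add, pow_add]
      have : ‖((PowerSeries.coeff (N + m) F : ℤ) : ℂ)‖ * (r0 ^ N * r0 ^ m) / r0 ^ N * (‖sv z‖ ^ 24) ^ N =
          ‖((PowerSeries.coeff (N + m) F : ℤ) : ℂ)‖ * ((‖sv z‖ ^ 24) ^ N * r0 ^ m) := by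
        field_simp
      rw [this]
      gcongr

lemma Ev.pow {A : PowerSeries ℤ} {x a : ℂ} (h : Ev A x a) (n : ℕ) : Ev (A ^ n) x (a ^ n) := by
  induction n with
  | zero => simpa using Ev.C 1 x
  | succ n ih => rw [pow_succ, pow_succ]; exact ih.mul h

lemma sv_tendsto : Tendsto (fun y : ℝ => ‖sv (y * I)‖ ^ 24) atTop (𝓝 0) := by
  have : Tendsto (fun y : ℝ => ‖sv (y * I)‖) atTop (𝓝 0) := by
    simp only [sv_norm]
    refine Real.tendsto_exp_atBot.comp ?_
    have := tendsto_id.const_mul_atTop_of_neg (show -2 * Real.pi < 0 by linarith [Real.pi_pos])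
    refine this.congr ?_
    intro y; simp
  simpa using this.pow 24

lemma formal_zero {F : PowerSeries ℤ} {v : ℂ → ℂ} (hv : ∀ z ∈ UU, Ev F (sv z ^ 24) (v z))
    (h0 : ∀ z ∈ UU, v z = 0) : F = 0 := by
  ext n
  rw [map_zero]
  induction n using Nat.strong_induction_on with
  | _ N ih =>
  set a := PowerSeries.coeff N F with ha
  have hv' : ∀ z ∈ UU, Ev (F - PowerSeries.C a * PowerSeries.X ^ N) (sv z ^ 24) (v z - a * (sv z ^ 24) ^ N) :=
    fun z hz => (hv z hz).sub ((Ev.C a _).mul ((Ev.X _).pow N))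
  obtain ⟨C, hC, hb⟩ := decay (N + 1) (fun n hn => by
    rw [map_sub, PowerSeries.coeff_C_mul, PowerSeries.coeff_X_pow]
    rcases Nat.lt_succ_iff_lt_or_eq.mp hn with h | h
    · rw [ih n h, if_neg (by omega)]; simp
    · subst h; simp [ha]) hv'
  have key : ∀ y : ℝ, 1 ≤ y → ‖(a : ℂ)‖ ≤ C * ‖sv (y * I)‖ ^ 24 := by
    intro y hy
    have h1 := hb (y * I) (by simpa using hy)
    rw [h0 _ (mem_UU_of (by simpa using hy)), zero_sub, norm_neg, norm_mul, norm_pow, norm_pow, pow_succ] at h1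
    have hp : 0 < (‖sv (y * I)‖ ^ 24) ^ N := by
      have := norm_pos_iff.mpr (sv_ne (y * I))
      positivity
    have h2 : ‖(a : ℂ)‖ * (‖sv (y * I)‖ ^ 24) ^ N ≤ (C * ‖sv (y * I)‖ ^ 24) * (‖sv (y * I)‖ ^ 24) ^ N := by
      calc _ ≤ _ := h1
        _ = _ := by ring
    exact le_of_mul_le_mul_right h2 hp
  have hl := ge_of_tendsto (sv_tendsto.const_mul C) (eventually_atTop.mpr ⟨1, key⟩)
  rw [mul_zero] at hl
  have := norm_le_zero_iff.mp hl
  exact_mod_cast this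

lemma ss_le {z : ℂ} (hz : 1 ≤ z.im) : ss z ^ 3 ≤ 8 := by
  have : ss z ≤ 2 := by
    unfold ss
    rw [Real.sqrt_le_left (by norm_num)]
    have : 1 / z.im ≤ 1 := by rw [div_le_one (by linarith)]; exact hz
    linarith
  calc ss z ^ 3 ≤ 2 ^ 3 := by gcongr; exact ss_nn z
    _ = 8 := by norm_num

lemma main_of (hF : ∀ n < 336, PowerSeries.coeff n (A0 - A1 - A2) = 0)
    (h1 : PowerSeries.coeff 1 (A0 + A1 - A2) ≠ 0) (h2 : PowerSeries.coeff 1 (A0 + A1 + A2) ≠ 0)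
    (h3 : PowerSeries.coeff 2 (A0 - A1 + A2) ≠ 0) : A0 = A1 + A2 := by
  have e0 := fun z (hz : z ∈ UU) => ((ev_A0 hz).sub (ev_A1 hz)).sub (ev_A2 hz)
  have e1 := fun z (hz : z ∈ UU) => ((ev_A0 hz).add (ev_A1 hz)).sub (ev_A2 hz)
  have e2 := fun z (hz : z ∈ UU) => ((ev_A0 hz).add (ev_A1 hz)).add (ev_A2 hz)
  have e3 := fun z (hz : z ∈ UU) => ((ev_A0 hz).sub (ev_A1 hz)).add (ev_A2 hz)
  have hGG : ∀ z ∈ UU, GG z = 0 := by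
    obtain ⟨C, hC, hb⟩ := decay 336 hF e0
    refine GG_zero (C * 2000 ^ 3) ?_
    intro z hz
    have hzU := mem_UU_of hz
    have b0 := u0_bound hzU
    have b1 := u1_bound hzU
    have b2 := u2_bound hzU
    have bs := ss_le hz
    have hq : ‖u0 z - u1 z - u2 z‖ ≤ C * Real.exp (-2 * Real.pi * 8065 * z.im) := by
      have h := hb z hz
      have e : u0 z / sv z ^ 3 - u1 z / sv z ^ 3 - u2 z / sv z ^ 3 = (u0 z - u1 z - u2 z) / sv z ^ 3 := by ring
      have hp : 0 < ‖sv z‖ := norm_pos_iff.mpr (sv_ne z)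
      rw [e, norm_div, norm_pow, div_le_iff₀ (by positivity)] at h
      refine h.trans ?_
      rw [mul_assoc, ← pow_mul, ← pow_add]
      gcongr
      rw [sv_norm, ← Real.exp_nat_mul]
      gcongr 1
      push_cast
      have := mul_pos Real.pi_pos (show 0 < z.im from hzU)
      nlinarith
    have n1 : ‖u0 z + u1 z - u2 z‖ ≤ 2000 := by
      have := norm_sub_le (u0 z + u1 z) (u2 z)
      have := norm_add_le (u0 z) (u1 z)
      linarith
    have n2 : ‖u0 z - u1 z + u2 z‖ ≤ 2000 := by
      have := norm_add_le (u0 z - u1 z) (u2 z)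
      have := norm_sub_le (u0 z) (u1 z)
      linarith
    have n3 : ‖u0 z + u1 z + u2 z‖ ≤ 2000 := by
      have := norm_add_le (u0 z + u1 z) (u2 z)
      have := norm_add_le (u0 z) (u1 z)
      linarith
    unfold GG
    rw [norm_mul, norm_mul, norm_mul]
    calc _ ≤ C * Real.exp (-2 * Real.pi * 8065 * z.im) * 2000 * 2000 * 2000 := by gcongr
      _ = _ := by ring
  have hs : ∀ z, sv z ^ 3 ≠ 0 := fun z => pow_ne_zero _ (sv_ne z)
  have d0 := (u0_diff.sub u1_diff).sub u2_diff
  have d1 := (u0_diff.add u1_diff).sub u2_diff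
  have d3 := (u0_diff.sub u1_diff).add u2_diff
  have d2 := (u0_diff.add u1_diff).add u2_diff
  rcases UU_dom ((d0.mul d1).mul d3) d2 hGG with h | h
  swap
  · exfalso; apply h2
    rw [formal_zero e2 fun z hz => ?_, map_zero]
    have : u0 z + u1 z + u2 z = 0 := h z hz
    rw [← add_div, ← add_div, this, zero_div]
  rcases UU_dom (d0.mul d1) d3 h with h | h
  swap
  · exfalso; apply h3
    rw [formal_zero e3 fun z hz => ?_, map_zero]
    have : u0 z - u1 z + u2 z = 0 := h z hz
    rw [← sub_div, ← add_div, this, zero_div]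
  rcases UU_dom d0 d1 h with h | h
  swap
  · exfalso; apply h1
    rw [formal_zero e1 fun z hz => ?_, map_zero]
    have : u0 z + u1 z - u2 z = 0 := h z hz
    rw [← add_div, ← sub_div, this, zero_div]
  have : A0 - A1 - A2 = 0 := formal_zero e0 fun z hz => by
    have : u0 z - u1 z - u2 z = 0 := h z hz
    rw [← sub_div, ← sub_div, this, zero_div]
  linear_combination this

end Thm11

namespace Thm11
open Polynomial in
/-- sparse polynomial -/
noncomputable def SS (L : List ℕ) : Polynomial ℕ := (L.map (fun e => (X : Polynomial ℕ) ^ e)).sum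

lemma SS_coeff (L : List ℕ) (n : ℕ) : (SS L).coeff n = L.count n := by
  unfold SS
  induction L with
  | nil => simp
  | cons e L ih =>
    rw [List.map_cons, List.sum_cons, Polynomial.coeff_add, ih, Polynomial.coeff_X_pow, List.count_cons]
    by_cases h : n = e
    · subst h; simp [add_comm]
    · have : ¬ e = n := fun h' => h h'.symm
      simp [h, this]

lemma SS_eval (L : List ℕ) (B : ℕ) : (SS L).eval B = (L.map (fun e => B ^ e)).sum := by
  unfold SS
  induction L with
  | nil => simp
  | cons e L ih => simp only [List.map_cons, List.sum_cons, Polynomial.eval_add, ih]; simp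

lemma coeff_le_eval_one (P : Polynomial ℕ) (n : ℕ) : P.coeff n ≤ P.eval 1 := by
  rw [Polynomial.eval_eq_sum_range]
  simp only [one_pow, mul_one]
  by_cases h : n ≤ P.natDegree
  · exact Finset.single_le_sum (f := fun i => P.coeff i) (fun _ _ => Nat.zero_le _) (by simp; omega)
  · rw [Polynomial.coeff_eq_zero_of_natDegree_lt (by omega)]; exact Nat.zero_le _

lemma kron (B : ℕ) (N : ℕ) : ∀ P Q : Polynomial ℕ, (∀ n, P.coeff n < B) → (∀ n, Q.coeff n < B) →
    P.eval B ≡ Q.eval B [MOD B ^ N] → ∀ n < N, P.coeff n = Q.coeff n := by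
  induction N with
  | zero => intro P Q _ _ _ n hn; omega
  | succ N ih =>
    intro P Q hP hQ h n hn
    have hB : 0 < B := lt_of_le_of_lt (Nat.zero_le _) (hP 0)
    have eP : P.eval B = P.divX.eval B * B + P.coeff 0 := by
      conv_lhs => rw [← P.divX_mul_X_add]
      simp
    have eQ : Q.eval B = Q.divX.eval B * B + Q.coeff 0 := by
      conv_lhs => rw [← Q.divX_mul_X_add]
      simp
    have h0 : P.coeff 0 = Q.coeff 0 := by
      have h1 : P.eval B ≡ Q.eval B [MOD B] := h.of_dvd (dvd_pow_self B (by omega))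
      rw [eP, eQ] at h1
      have h2 : P.coeff 0 ≡ Q.coeff 0 [MOD B] := by
        have : ∀ a b : ℕ, (a * B + b) % B = b % B := fun a b => by simp
        unfold Nat.ModEq at h1 ⊢
        rwa [this, this] at h1
      exact h2.eq_of_lt_of_lt (hP 0) (hQ 0)
    cases n with
    | zero => exact h0
    | succ n =>
      rw [← Polynomial.coeff_divX, ← Polynomial.coeff_divX]
      refine ih _ _ (fun n => by rw [Polynomial.coeff_divX]; exact hP _)
        (fun n => by rw [Polynomial.coeff_divX]; exact hQ _) ?_ n (by omega)
      rw [eP, eQ, h0] at h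
      have h3 := Nat.ModEq.add_right_cancel' _ h
      rw [pow_succ] at h3
      exact Nat.ModEq.mul_right_cancel' (by omega) h3

/-- index list -/
def ms : List ℤ := (List.range 51).map (fun i : ℕ => (i : ℤ) - 25)
/-- index list -/
def mp : List ℤ := (List.range 26).map (fun i : ℕ => (i : ℤ))

lemma mem_ms (m : ℤ) : m ∈ ms ↔ -25 ≤ m ∧ m ≤ 25 := by
  unfold ms
  simp only [List.mem_map, List.mem_range]
  constructor
  · rintro ⟨i, hi, rfl⟩; omega
  · intro h; exact ⟨(m + 25).toNat, by omega, by omega⟩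

lemma mem_mp (m : ℤ) : m ∈ mp ↔ 0 ≤ m ∧ m ≤ 25 := by
  unfold mp
  simp only [List.mem_map, List.mem_range]
  constructor
  · rintro ⟨i, hi, rfl⟩; omega
  · intro h; exact ⟨m.toNat, by omega, by omega⟩

lemma nodup_ms : ms.Nodup := List.nodup_range.map (fun a b h => by simpa using h)
lemma nodup_mp : mp.Nodup := List.nodup_range.map (fun a b h => by simpa using h)

lemma theta_count (s : Set ℤ) (l : List ℤ) (hl : l.Nodup) (E : ℤ → ℕ) (n : ℕ)
    (h : ∀ m, m ∈ s ↔ m ∈ l ∧ E m = n) : s.ncard = (l.map E).count n := by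
  have hs : s = ((l.filter (fun m => E m = n)).toFinset : Set ℤ) := by
    ext m; simp [h]
  rw [hs, Set.ncard_coe_finset, List.toFinset_card_of_nodup (hl.filter _), List.count_eq_countP, List.countP_map,
    List.countP_eq_length_filter]
  congr 2

/-- exponents -/
def Lphi (k : ℕ) : List ℕ := ms.map fun m : ℤ => ((k : ℤ) * m ^ 2).toNat
/-- exponents -/
def Lpsi (k : ℕ) : List ℕ := mp.map fun m : ℤ => ((k : ℤ) * (m * (m + 1) / 2)).toNat
/-- exponents -/
def LA : List ℕ := ms.map fun m => (((1 : ℕ) : ℤ) * (m * (3 * m + 1) / 2)).toNat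
/-- exponents -/
def LB : List ℕ := ms.map fun m => (((7 : ℕ) : ℤ) * (m * (3 * m + 2))).toNat

lemma phi_coeff {k : ℕ} (hk : 0 < k) {n : ℕ} (hn : n < 336) :
    PowerSeries.coeff n (phi k) = ((SS (Lphi k)).coeff n : ℤ) := by
  rw [SS_coeff]
  unfold phi Lphi
  rw [PowerSeries.coeff_mk]
  congr 1
  refine theta_count _ _ nodup_ms _ _ fun m => ?_
  rw [mem_ms]
  show (n : ℤ) = k * m ^ 2 ↔ _
  have h0 : (0 : ℤ) ≤ k * m ^ 2 := by positivity
  have h1 : m ^ 2 ≤ k * m ^ 2 := by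
    have : (1 : ℤ) ≤ k := by exact_mod_cast hk
    nlinarith [sq_nonneg m]
  constructor
  · intro h
    refine ⟨⟨?_, ?_⟩, ?_⟩
    · nlinarith
    · nlinarith
    · omega
  · rintro ⟨-, h⟩; omega

lemma psi_coeff {k : ℕ} (hk : 0 < k) {n : ℕ} (hn : n < 336) :
    PowerSeries.coeff n (psi k) = ((SS (Lpsi k)).coeff n : ℤ) := by
  rw [SS_coeff]
  unfold psi Lpsi
  rw [PowerSeries.coeff_mk]
  congr 1
  refine theta_count _ _ nodup_mp _ _ fun m => ?_
  rw [mem_mp]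
  show 0 ≤ m ∧ (n : ℤ) = k * (m * (m + 1) / 2) ↔ _
  constructor
  · rintro ⟨hm, h⟩
    have e2 : m * (m + 1) / 2 * 2 = m * (m + 1) := Int.ediv_mul_cancel (Int.even_mul_succ_self m).two_dvd
    have h1 : m * (m + 1) / 2 ≤ k * (m * (m + 1) / 2) := by
      have : (1 : ℤ) ≤ k := by exact_mod_cast hk
      have : 0 ≤ m * (m + 1) / 2 := by nlinarith
      nlinarith
    refine ⟨⟨hm, ?_⟩, ?_⟩
    · nlinarith
    · omega
  · rintro ⟨⟨hm, -⟩, h⟩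
    have e2 : m * (m + 1) / 2 * 2 = m * (m + 1) := Int.ediv_mul_cancel (Int.even_mul_succ_self m).two_dvd
    have : 0 ≤ m * (m + 1) / 2 := by nlinarith
    have : 0 ≤ k * (m * (m + 1) / 2) := by positivity
    exact ⟨hm, by omega⟩

lemma fA_coeff {n : ℕ} (hn : n < 336) :
    PowerSeries.coeff n (fA 1) = ((SS LA).coeff n : ℤ) := by
  rw [SS_coeff]
  unfold fA LA
  rw [PowerSeries.coeff_mk]
  congr 1
  refine theta_count _ _ nodup_ms _ _ fun m => ?_
  rw [mem_ms]
  show (n : ℤ) = (1 : ℕ) * (m * (3 * m + 1) / 2) ↔ _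
  have nn : 0 ≤ m * (3 * m + 1) := by
    rcases le_or_gt 0 m with h | h
    · positivity
    · nlinarith
  generalize hw : m * (3 * m + 1) = w at *
  constructor
  · intro h
    have : w < 673 := by omega
    refine ⟨⟨?_, ?_⟩, ?_⟩
    · nlinarith
    · nlinarith
    · omega
  · rintro ⟨-, h⟩; omega

lemma fB_coeff {n : ℕ} (hn : n < 336) :
    PowerSeries.coeff n (fB 7) = ((SS LB).coeff n : ℤ) := by
  rw [SS_coeff]
  unfold fB LB
  rw [PowerSeries.coeff_mk]
  congr 1
  refine theta_count _ _ nodup_ms _ _ fun m => ?_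
  rw [mem_ms]
  show (n : ℤ) = (7 : ℕ) * (m * (3 * m + 2)) ↔ _
  have nn : 0 ≤ m * (3 * m + 2) := by
    rcases le_or_gt 0 m with h | h
    · positivity
    · nlinarith
  generalize hw : m * (3 * m + 2) = w at *
  constructor
  · intro h
    have : w < 336 := by omega
    refine ⟨⟨?_, ?_⟩, ?_⟩
    · nlinarith
    · nlinarith
    · omega
  · rintro ⟨-, h⟩; omega

/-- embedding -/
noncomputable def Phi : Polynomial ℕ →+* PowerSeries ℤ :=
  (Polynomial.coeToPowerSeries.ringHom).comp (Polynomial.mapRingHom (Nat.castRingHom ℤ))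

lemma Phi_coeff (p : Polynomial ℕ) (n : ℕ) : PowerSeries.coeff n (Phi p) = (p.coeff n : ℤ) := by
  simp [Phi]

lemma Phi_X : Phi Polynomial.X = PowerSeries.X := by
  simp [Phi]

/-- quotient map -/
noncomputable def qm : PowerSeries ℤ →+* PowerSeries ℤ ⧸ Ideal.span {(PowerSeries.X : PowerSeries ℤ) ^ 336} :=
  Ideal.Quotient.mk _

lemma qm_eq_iff (A B : PowerSeries ℤ) : qm A = qm B ↔ ∀ n < 336, PowerSeries.coeff n A = PowerSeries.coeff n B := by
  unfold qm
  rw [Ideal.Quotient.eq, Ideal.mem_span_singleton, PowerSeries.X_pow_dvd_iff]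
  simp only [map_sub, sub_eq_zero]

/-- left combination -/
def cL {R : Type*} [CommSemiring R] (p1 f1 : R) : R := p1 * f1 ^ 2
/-- right combination -/
def cR {R : Type*} [CommSemiring R] (x p1 f7 p2 p7 p14 p3 f21 a b : R) : R :=
  p1 * f7 ^ 2 + (4 * x * p2 * p7 * f7 + (8 * x ^ 2 * p14 * p3 * f21 + 8 * x ^ 4 * p14 * a * b))

/-- left polynomial -/
noncomputable def PL : Polynomial ℕ := cL (SS (Lpsi 1)) (SS (Lphi 1))
/-- right polynomial -/
noncomputable def PR : Polynomial ℕ := cR Polynomial.X (SS (Lpsi 1)) (SS (Lphi 7)) (SS (Lpsi 2))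
  (SS (Lpsi 7)) (SS (Lpsi 14)) (SS (Lpsi 3)) (SS (Lphi 21)) (SS LA) (SS LB)

/-- value -/
def vl (B : ℕ) (L : List ℕ) : ℕ := (L.map (fun e => B ^ e)).sum

/-- value -/
def VL (B : ℕ) : ℕ := cL (vl B (Lpsi 1)) (vl B (Lphi 1))
/-- value -/
def VR (B : ℕ) : ℕ := cR B (vl B (Lpsi 1)) (vl B (Lphi 7)) (vl B (Lpsi 2))
  (vl B (Lpsi 7)) (vl B (Lpsi 14)) (vl B (Lpsi 3)) (vl B (Lphi 21)) (vl B LA) (vl B LB)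

lemma SS_vl (L : List ℕ) (B : ℕ) : (SS L).eval B = vl B L := SS_eval L B

lemma cL_map {R S : Type*} [CommSemiring R] [CommSemiring S] (φ : R →+* S) (p1 f1 : R) :
    φ (cL p1 f1) = cL (φ p1) (φ f1) := by
  unfold cL
  simp only [map_mul, map_pow]

lemma cR_map {R S : Type*} [CommSemiring R] [CommSemiring S] (φ : R →+* S)
    (x p1 f7 p2 p7 p14 p3 f21 a b : R) :
    φ (cR x p1 f7 p2 p7 p14 p3 f21 a b) =
      cR (φ x) (φ p1) (φ f7) (φ p2) (φ p7) (φ p14) (φ p3) (φ f21) (φ a) (φ b) := by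
  unfold cR
  simp only [map_mul, map_pow, map_add, map_ofNat]

lemma PL_eval (B : ℕ) : PL.eval B = VL B := by
  have h := cL_map (Polynomial.evalRingHom B) (SS (Lpsi 1)) (SS (Lphi 1))
  simp only [Polynomial.coe_evalRingHom, SS_vl] at h
  exact h

lemma PR_eval (B : ℕ) : PR.eval B = VR B := by
  have h := cR_map (Polynomial.evalRingHom B) Polynomial.X (SS (Lpsi 1)) (SS (Lphi 7)) (SS (Lpsi 2))
    (SS (Lpsi 7)) (SS (Lpsi 14)) (SS (Lpsi 3)) (SS (Lphi 21)) (SS LA) (SS LB)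
  simp only [Polynomial.coe_evalRingHom, SS_vl, Polynomial.eval_X] at h
  exact h

lemma b1 : VL 1 < 2 ^ 24 := by decide +kernel
lemma b2 : VR 1 < 2 ^ 24 := by decide +kernel
lemma b3 : VL (2 ^ 24) % (2 ^ 24) ^ 336 = VR (2 ^ 24) % (2 ^ 24) ^ 336 := by decide +kernel

lemma PLR_of (B N : ℕ) (h1 : VL 1 < B) (h2 : VR 1 < B) (h3 : VL B % B ^ N = VR B % B ^ N)
    {n : ℕ} (hn : n < N) : PL.coeff n = PR.coeff n := by
  refine kron B N PL PR (fun n => ?_) (fun n => ?_) ?_ n hn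
  · exact (coeff_le_eval_one _ _).trans_lt (by rw [PL_eval]; exact h1)
  · exact (coeff_le_eval_one _ _).trans_lt (by rw [PR_eval]; exact h2)
  · rw [PL_eval, PR_eval]; exact h3

lemma PLR {n : ℕ} (hn : n < 336) : PL.coeff n = PR.coeff n :=
  PLR_of (2 ^ 24) 336 b1 b2 b3 hn

lemma q_phi {k : ℕ} (hk : 0 < k) : qm (phi k) = qm (Phi (SS (Lphi k))) :=
  (qm_eq_iff _ _).mpr fun n hn => by rw [phi_coeff hk hn, Phi_coeff]
lemma q_psi {k : ℕ} (hk : 0 < k) : qm (psi k) = qm (Phi (SS (Lpsi k))) :=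
  (qm_eq_iff _ _).mpr fun n hn => by rw [psi_coeff hk hn, Phi_coeff]
lemma q_fA : qm (fA 1) = qm (Phi (SS LA)) :=
  (qm_eq_iff _ _).mpr fun n hn => by rw [fA_coeff hn, Phi_coeff]
lemma q_fB : qm (fB 7) = qm (Phi (SS LB)) :=
  (qm_eq_iff _ _).mpr fun n hn => by rw [fB_coeff hn, Phi_coeff]

lemma cLR {R : Type*} [CommRing R] (x p1 f1 f7 p2 p7 p14 p3 f21 a b : R)
    (h : cL p1 f1 = cR x p1 f7 p2 p7 p14 p3 f21 a b) :
    p1 * (f1 ^ 2 - f7 ^ 2) = 4 * x * p2 * p7 * f7 + (8 * x ^ 2 * p14 * p3 * f21 + 8 * x ^ 4 * p14 * a * b) := by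
  unfold cL cR at h
  linear_combination h

lemma q_main : qm A0 = qm (A1 + A2) := by
  have h : qm (Phi PL) = qm (Phi PR) := (qm_eq_iff _ _).mpr fun n hn => by
    rw [Phi_coeff, Phi_coeff, PLR hn]
  unfold PL PR at h
  rw [cL_map, cL_map, cR_map, cR_map, Phi_X, ← q_fA, ← q_fB, ← q_phi (show 0 < 1 by norm_num),
    ← q_phi (show 0 < 7 by norm_num), ← q_phi (show 0 < 21 by norm_num),
    ← q_psi (show 0 < 1 by norm_num), ← q_psi (show 0 < 2 by norm_num), ← q_psi (show 0 < 3 by norm_num),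
    ← q_psi (show 0 < 7 by norm_num), ← q_psi (show 0 < 14 by norm_num)] at h
  have h2 := cLR _ _ _ _ _ _ _ _ _ _ _ h
  unfold A0 A1 A2
  simp only [map_mul, map_add, map_sub, map_pow, map_ofNat]
  exact h2

lemma cc_phi {k : ℕ} (hk : 0 < k) : PowerSeries.constantCoeff (phi k) = 1 := by
  rw [← PowerSeries.coeff_zero_eq_constantCoeff_apply]
  unfold phi
  rw [PowerSeries.coeff_mk]
  have : {m : ℤ | ((0 : ℕ) : ℤ) = k * m ^ 2} = {0} := by
    ext m
    show ((0 : ℕ) : ℤ) = k * m ^ 2 ↔ m = 0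
    have : (k : ℤ) ≠ 0 := by positivity
    constructor
    · intro h
      have := h.symm
      simpa [hk.ne'] using this
    · rintro rfl; simp
  rw [this]; simp

lemma cc_psi {k : ℕ} (hk : 0 < k) : PowerSeries.constantCoeff (psi k) = 1 := by
  rw [← PowerSeries.coeff_zero_eq_constantCoeff_apply]
  unfold psi
  rw [PowerSeries.coeff_mk]
  have : {m : ℤ | 0 ≤ m ∧ ((0 : ℕ) : ℤ) = k * (m * (m + 1) / 2)} = {0} := by
    ext m
    show 0 ≤ m ∧ ((0 : ℕ) : ℤ) = k * (m * (m + 1) / 2) ↔ m = 0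
    have : (k : ℤ) ≠ 0 := by positivity
    constructor
    · rintro ⟨hm, h⟩
      have e2 : m * (m + 1) / 2 * 2 = m * (m + 1) := Int.ediv_mul_cancel (Int.even_mul_succ_self m).two_dvd
      have h' : m * (m + 1) / 2 = 0 := by
        rcases mul_eq_zero.mp h.symm with h | h
        · exact absurd h this
        · exact h
      rw [h'] at e2
      nlinarith
    · rintro rfl; simp
  rw [this]; simp

lemma c1A1 : PowerSeries.coeff 1 A1 = 4 := by
  have : A1 = PowerSeries.X ^ 1 * (PowerSeries.C 4 * (psi 2 * psi 7 * phi 7)) := by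
    unfold A1; simp only [map_ofNat]; ring
  rw [this, PowerSeries.coeff_X_pow_mul', if_pos le_rfl]
  simp [cc_phi, cc_psi, map_ofNat]

lemma A2_eq : A2 = PowerSeries.X ^ 2 * (PowerSeries.C 8 * (psi 14 * psi 3 * phi 21) +
    PowerSeries.X * (PowerSeries.C 8 * (PowerSeries.X * psi 14 * fA 1 * fB 7))) := by
  unfold A2; simp only [map_ofNat]; ring

lemma c1A2 : PowerSeries.coeff 1 A2 = 0 := by
  rw [A2_eq, PowerSeries.coeff_X_pow_mul', if_neg (by norm_num)]

lemma c2A2 : PowerSeries.coeff 2 A2 = 8 := by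
  rw [A2_eq, PowerSeries.coeff_X_pow_mul', if_pos le_rfl]
  simp [cc_phi, cc_psi, map_ofNat]

lemma main : A0 = A1 + A2 := by
  have h := (qm_eq_iff _ _).mp q_main
  refine main_of ?_ ?_ ?_ ?_
  · intro n hn
    rw [map_sub, map_sub, h n hn, map_add]; ring
  · rw [map_sub, map_add, h 1 (by norm_num), map_add, c1A1, c1A2]; norm_num
  · rw [map_add, map_add, h 1 (by norm_num), map_add, c1A1, c1A2]; norm_num
  · rw [map_add, map_sub, h 2 (by norm_num), map_add, c2A2]; ring_nf; norm_num

end Thm11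

/-- Theorem 1.1, first identity. Here `f(q,q²)` is `fA 1` and `f(q⁷,q³⁵)` is `fB 7`. -/
theorem thm_1_1_first :
    psi 1 * (phi 1 ^ 2 - phi 7 ^ 2) =
      4 * X * psi 2 * psi 7 * phi 7 + 8 * X ^ 2 * psi 14 * psi 3 * phi 21
        + 8 * X ^ 4 * psi 14 * fA 1 * fB 7 := by
  have h := Thm11.main
  unfold Thm11.A0 Thm11.A1 Thm11.A2 at h
  rw [h]; ring
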